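/- Let Γ_n be the directed graph whose vertices are the isomorphism classes of cubic graphs on 2n vertices, with one directed edge from g₁ to g₂ for each Whitehead move w_ε, ε ∈ E(g₁), such that w_ε(g₁) is isomorphic to g₂. Then Γ_n is strongly connected and its outer conductance φ_out(Γ_n) tends to 0 as n → ∞; in particular, the family {Γ_n}_{n≥1} is not a family of outer-expanders. -/

import Mathlib

/-! Cubic multigraphs in the dart (half-edge) model, Whitehead moves,
and the "graph of graphs" `Γ_n`. -/

/-- A cubic multigraph on the `2 * n` vertices `Fin (2 * n)`, in the dart (half-edge) model:
darts are `Fin (6 * n)`, `dinv` is the fixed-point-free involution exchanging the two darts of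
each edge, and `vert` assigns to each dart its base vertex.  Loops and multiple edges are
allowed; `regular` says every vertex carries exactly three darts. -/
structure CubicGraph (n : ℕ) where
  vert : Fin (6 * n) → Fin (2 * n)
  dinv : Fin (6 * n) → Fin (6 * n)
  dinv_invol : ∀ d, dinv (dinv d) = d
  dinv_ne : ∀ d, dinv d ≠ d
  regular : ∀ v : Fin (2 * n), (Finset.univ.filter fun d => vert d = v).card = 3

namespace CubicGraph

variable {n : ℕ}

/-- Two darts are joined if they can be connected by a chain of
"same vertex" / "other half of the same edge" steps. -/
def Reach (g : CubicGraph n) : Fin (6 * n) → Fin (6 * n) → Prop :=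
  Relation.ReflTransGen fun a b => g.vert a = g.vert b ∨ g.dinv a = b

/-- Connectivity of a cubic multigraph. -/
def Connected (g : CubicGraph n) : Prop := ∀ d d', g.Reach d d'

/-- The edge of the dart `d` is a loop. -/
def IsLoop (g : CubicGraph n) (d : Fin (6 * n)) : Prop := g.vert (g.dinv d) = g.vert d

instance (g : CubicGraph n) (d : Fin (6 * n)) : Decidable (g.IsLoop d) :=
  inferInstanceAs (Decidable (_ = _))

lemma card_filter_comp_swap (g : CubicGraph n) (q r : Fin (6 * n)) (v : Fin (2 * n)) :
    (Finset.univ.filter fun d => g.vert (Equiv.swap q r d) = v).card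
      = (Finset.univ.filter fun d => g.vert d = v).card := by
  refine Finset.card_bij (fun d _ => Equiv.swap q r d) ?_ ?_ ?_
  · intro a ha
    simp only [Finset.mem_filter, Finset.mem_univ, true_and] at ha ⊢
    exact ha
  · intro a _ b _ h
    exact (Equiv.swap q r).injective h
  · intro b hb
    simp only [Finset.mem_filter, Finset.mem_univ, true_and] at hb
    exact ⟨Equiv.swap q r b, by simp [hb], by simp⟩

/-- Exchange the base vertices of the two darts `q` and `r`, keeping everything else. -/
def swapDarts (g : CubicGraph n) (q r : Fin (6 * n)) : CubicGraph n where
  vert := fun d => g.vert (Equiv.swap q r d)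
  dinv := g.dinv
  dinv_invol := g.dinv_invol
  dinv_ne := g.dinv_ne
  regular := fun v => (g.card_filter_comp_swap q r v).trans (g.regular v)

/-- The darts based at the same vertex as `x`, other than `x` itself. -/
def othersAt (g : CubicGraph n) (x : Fin (6 * n)) : Finset (Fin (6 * n)) :=
  (Finset.univ.filter fun d => g.vert d = g.vert x).erase x

lemma othersAt_nonempty (g : CubicGraph n) (x : Fin (6 * n)) :
    (g.othersAt x).Nonempty := by
  have hx : x ∈ Finset.univ.filter fun d => g.vert d = g.vert x := by simp
  have h : (g.othersAt x).card = 2 := by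
    rw [othersAt, Finset.card_erase_of_mem hx, g.regular]
  rw [← Finset.card_pos, h]
  norm_num

def oMin (g : CubicGraph n) (x : Fin (6 * n)) : Fin (6 * n) :=
  (g.othersAt x).min' (g.othersAt_nonempty x)

def oMax (g : CubicGraph n) (x : Fin (6 * n)) : Fin (6 * n) :=
  (g.othersAt x).max' (g.othersAt_nonempty x)

/-- The two Whitehead moves (indexed by `i : Fin 2`) performed on the edge containing the dart
`x`.  On a loop the move leaves the graph unchanged; on a non-loop edge the two darts at the
endpoints of the edge other than the edge's own darts are re-attached in one of the two
possible new ways (realized by transporting one dart from each endpoint to the other). -/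
def wh (g : CubicGraph n) (i : Fin 2) (x : Fin (6 * n)) : CubicGraph n :=
  if g.IsLoop x then g
  else if i = 0 then g.swapDarts (g.oMax x) (g.oMin (g.dinv x))
  else g.swapDarts (g.oMax x) (g.oMax (g.dinv x))

/-- An isomorphism of cubic multigraphs: a bijection of darts together with a compatible
bijection of vertices, commuting with the edge involutions. -/
structure Iso (g₁ g₂ : CubicGraph n) where
  dartEquiv : Fin (6 * n) ≃ Fin (6 * n)
  vertEquiv : Fin (2 * n) ≃ Fin (2 * n)
  map_dinv : ∀ d, g₂.dinv (dartEquiv d) = dartEquiv (g₁.dinv d)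
  map_vert : ∀ d, g₂.vert (dartEquiv d) = vertEquiv (g₁.vert d)

def IsIsomorphic (g₁ g₂ : CubicGraph n) : Prop := Nonempty (Iso g₁ g₂)

/-- Reachability avoiding the edge of the dart `x` (i.e. in the graph with that edge removed). -/
def ReachAvoiding (g : CubicGraph n) (x : Fin (6 * n)) :
    Fin (6 * n) → Fin (6 * n) → Prop :=
  Relation.ReflTransGen fun a b =>
    g.vert a = g.vert b ∨ (g.dinv a = b ∧ a ≠ x ∧ a ≠ g.dinv x)

/-- The edge of `x` is a bridge: removing it disconnects the graph. -/
def IsBridge (g : CubicGraph n) (x : Fin (6 * n)) : Prop :=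
  ¬ ∀ d d', g.ReachAvoiding x d d'

/-- A (connected) graph is bridged if it has at least one bridge. -/
def Bridged (g : CubicGraph n) : Prop := ∃ x, g.IsBridge x

/-- A graph is bridgeless if it has no bridge. -/
def Bridgeless (g : CubicGraph n) : Prop := ∀ x, ¬ g.IsBridge x

/-- `c` lists consecutive darts of a cycle of length `k`: the vertices visited are pairwise
distinct, the end of each dart's edge is the base of the next one (cyclically), and the `k`
edges used are pairwise distinct. -/
def IsCycle (g : CubicGraph n) (k : ℕ) (c : Fin k → Fin (6 * n)) : Prop :=
  (∀ i : Fin k,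
    g.vert (g.dinv (c i)) = g.vert (c ⟨(i.1 + 1) % k, Nat.mod_lt _ i.pos⟩)) ∧
  Function.Injective (fun i => g.vert (c i)) ∧
  ∀ i j : Fin k, c j ≠ g.dinv (c i)

/-- The cycle `c` is indecomposable (induced): no edge of `g` other than the cycle's own
edges joins two vertices of the cycle. -/
def Indecomposable (g : CubicGraph n) (k : ℕ) (c : Fin k → Fin (6 * n)) : Prop :=
  ∀ d, (∃ i, g.vert d = g.vert (c i)) → (∃ j, g.vert (g.dinv d) = g.vert (c j)) →
    ∃ i, d = c i ∨ d = g.dinv (c i)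

/-- The girth: the least length of a cycle. -/
noncomputable def girth (g : CubicGraph n) : ℕ :=
  sInf {k | 0 < k ∧ ∃ c : Fin k → Fin (6 * n), g.IsCycle k c}

/-- The only cycles of the graph are loops. -/
def OnlyLoopCycles (g : CubicGraph n) : Prop :=
  ∀ k, 2 ≤ k → ∀ c : Fin k → Fin (6 * n), ¬ g.IsCycle k c

/-- The number of darts lying on loops (each loop contributes two darts). -/
def loopCount (g : CubicGraph n) : ℕ :=
  (Finset.univ.filter fun d => g.IsLoop d).card

end CubicGraph

instance {n : ℕ} : Finite (CubicGraph n) := by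
  have hinj : Function.Injective fun g : CubicGraph n => (g.vert, g.dinv) := by
    rintro ⟨v₁, i₁, _, _, _⟩ ⟨v₂, i₂, _, _, _⟩ h
    simp only [Prod.mk.injEq] at h
    obtain ⟨h₁, h₂⟩ := h
    subst h₁; subst h₂; rfl
  exact Finite.of_injective _ hinj

/-- Isomorphism of connected cubic graphs. -/
def cgIso {n : ℕ} (g₁ g₂ : {g : CubicGraph n // g.Connected}) : Prop :=
  CubicGraph.IsIsomorphic g₁.1 g₂.1

/-- The vertex set of the graph of graphs `Γ_n`: isomorphism classes of connected cubic
multigraphs on `2 * n` vertices. -/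
abbrev GammaV (n : ℕ) := Quot (@cgIso n)

/-- The number of directed edges of `Γ_n` from the class `u` to the class `v`: one edge for
each Whitehead move of a representative of `u` whose result lies in the class `v`.  A move
specification is a pair `(i, x)` of a move type `i : Fin 2` and a dart `x`; each of the two
Whitehead moves of each edge is counted by exactly two specifications (one for each of the
two darts of the edge), whence the division by `2`. -/
noncomputable def edgeMult (n : ℕ) (u v : GammaV n) : ℕ :=
  Nat.card {p : Fin 2 × Fin (6 * n) //
    CubicGraph.IsIsomorphic ((Quot.out u).1.wh p.1 p.2) (Quot.out v).1} / 2

/-- The sum of out-degrees of the classes in `S` (every class has out-degree `6 * n`: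
two Whitehead moves for each of the `3 * n` edges). -/
noncomputable def dOut (n : ℕ) (S : Set (GammaV n)) : ℕ :=
  Nat.card {q : GammaV n × Fin 2 × Fin (6 * n) // q.1 ∈ S} / 2

/-- The number of directed edges of `Γ_n` from `S` to its complement. -/
noncomputable def boundaryCount (n : ℕ) (S : Set (GammaV n)) : ℕ :=
  Nat.card {q : GammaV n × Fin 2 × Fin (6 * n) // q.1 ∈ S ∧
    ∀ v : GammaV n,
      CubicGraph.IsIsomorphic ((Quot.out q.1).1.wh q.2.1 q.2.2) (Quot.out v).1 → v ∉ S} / 2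

/-- The outer conductance of a set `S` of vertices of `Γ_n`. -/
noncomputable def phiOutSet (n : ℕ) (S : Set (GammaV n)) : ℝ :=
  (boundaryCount n S : ℝ) / min (dOut n S : ℝ) (dOut n Sᶜ : ℝ)

/-- The outer conductance of `Γ_n`: the infimum of the outer conductances of nonempty
proper subsets of vertices. -/
noncomputable def phiOut (n : ℕ) : ℝ :=
  sInf {x : ℝ | ∃ S : Set (GammaV n), S.Nonempty ∧ Sᶜ.Nonempty ∧ x = phiOutSet n S}

/-- The set of classes of bridged cubic graphs. -/
def bridgedSet (n : ℕ) : Set (GammaV n) := {u | (Quot.out u).1.Bridged}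

namespace CubicGraph

variable {n : ℕ}

/-- `x` is a dart of a non-loop edge, and `q`, `r` are darts at its two ends which do not belong
to that edge. -/
def Site (g : CubicGraph n) (x q r : Fin (6 * n)) : Prop :=
  g.vert q = g.vert x ∧ q ≠ x ∧ g.vert r = g.vert (g.dinv x) ∧ r ≠ g.dinv x ∧
    g.vert (g.dinv x) ≠ g.vert x

lemma swapDarts_dinv (g : CubicGraph n) (q r d : Fin (6 * n)) :
    (g.swapDarts q r).dinv d = g.dinv d := rfl

lemma swapDarts_vert (g : CubicGraph n) (q r d : Fin (6 * n)) :
    (g.swapDarts q r).vert d =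
      if d = q then g.vert r else if d = r then g.vert q else g.vert d := by
  simp only [swapDarts, Equiv.swap_apply_def]
  split_ifs <;> rfl

lemma swapDarts_swapDarts (g : CubicGraph n) (q r : Fin (6 * n)) :
    (g.swapDarts q r).swapDarts r q = g := by
  cases g
  simp [swapDarts, Equiv.swap_comm r q]

lemma exists_third (g : CubicGraph n) {x q : Fin (6 * n)} (hv : g.vert q = g.vert x)
    (hq : q ≠ x) :
    ∃ y, y ≠ x ∧ y ≠ q ∧ g.vert y = g.vert x ∧
      ∀ d, g.vert d = g.vert x → d = x ∨ d = q ∨ d = y := by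
  obtain ⟨a, b, c, hab, hac, hbc, h⟩ := Finset.card_eq_three.1 (g.regular (g.vert x))
  have key : ∀ d, g.vert d = g.vert x ↔ d = a ∨ d = b ∨ d = c := by
    intro d
    simpa using congrArg (d ∈ ·) h
  have hx := (key x).1 rfl
  have hq' := (key q).1 hv
  simp only [key]
  have : ∃ y, (y = a ∨ y = b ∨ y = c) ∧ y ≠ x ∧ y ≠ q := by
    by_contra! hc
    have := hc a
    have := hc b
    have := hc c
    grind
  obtain ⟨y, hy, hyx, hyq⟩ := this
  refine ⟨y, hyx, hyq, hy, fun d hd => ?_⟩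
  grind

lemma eq_or_eq_of_vert_eq (g : CubicGraph n) {x q y d : Fin (6 * n)} (hq : g.vert q = g.vert x)
    (hy : g.vert y = g.vert x) (hd : g.vert d = g.vert x) (h₁ : q ≠ x) (h₂ : y ≠ x)
    (h₃ : y ≠ q) : d = x ∨ d = q ∨ d = y := by
  obtain ⟨z, -, -, -, hz⟩ := g.exists_third hq h₁
  have := hz y hy
  have := hz d hd
  grind

lemma vert_surjective (g : CubicGraph n) : Function.Surjective g.vert := by
  intro v
  have h : 0 < (Finset.univ.filter fun d => g.vert d = v).card := by rw [g.regular]; norm_num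
  obtain ⟨d, hd⟩ := Finset.card_pos.1 h
  exact ⟨d, by simpa using hd⟩

lemma IsIsomorphic.of_darts {g h : CubicGraph n} (σ : Equiv.Perm (Fin (6 * n)))
    (hd : ∀ d, h.dinv (σ d) = σ (g.dinv d))
    (hv : ∀ a b, g.vert a = g.vert b → h.vert (σ a) = h.vert (σ b)) : g.IsIsomorphic h := by
  choose s hs using g.vert_surjective
  have hf : ∀ d, h.vert (σ d) = h.vert (σ (s (g.vert d))) := fun d => hv _ _ (hs _).symm
  have hsurj : Function.Surjective fun v => h.vert (σ (s v)) := by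
    intro v
    obtain ⟨d, rfl⟩ := h.vert_surjective v
    exact ⟨g.vert (σ.symm d), by simp [← hf]⟩
  exact ⟨σ, Equiv.ofBijective _ (Finite.injective_iff_bijective.1
    (Finite.injective_iff_surjective.2 hsurj)), hd, hf⟩

lemma IsIsomorphic.refl (g : CubicGraph n) : g.IsIsomorphic g :=
  ⟨Equiv.refl _, Equiv.refl _, fun _ => rfl, fun _ => rfl⟩

lemma IsIsomorphic.symm {g h : CubicGraph n} : g.IsIsomorphic h → h.IsIsomorphic g := by
  rintro ⟨f⟩
  refine .of_darts f.dartEquiv.symm (fun d => ?_) (fun a b hab => ?_)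
  · rw [Equiv.eq_symm_apply, ← f.map_dinv, Equiv.apply_symm_apply]
  · apply f.vertEquiv.injective
    simpa [← f.map_vert] using hab

lemma IsIsomorphic.trans {g h k : CubicGraph n} :
    g.IsIsomorphic h → h.IsIsomorphic k → g.IsIsomorphic k := by
  rintro ⟨f⟩ ⟨f'⟩
  exact ⟨f.dartEquiv.trans f'.dartEquiv, f.vertEquiv.trans f'.vertEquiv,
    fun d => by simp [f.map_dinv, f'.map_dinv], fun d => by simp [f.map_vert, f'.map_vert]⟩

/-- Exchanging the other two darts at the ends of an edge yields the same graph. -/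
lemma Site.swapDarts_isIsomorphic {g : CubicGraph n} {x q r q' r' : Fin (6 * n)}
    (h : g.Site x q r) (h' : g.Site x q' r') (hq : q' ≠ q) (hr : r' ≠ r) :
    (g.swapDarts q r).IsIsomorphic (g.swapDarts q' r') := by
  obtain ⟨h1, h2, h3, h4, h5⟩ := h
  obtain ⟨h1', h2', h3', h4', -⟩ := h'
  have hx := g.dinv_invol x
  refine .of_darts (Equiv.swap x (g.dinv x)) (fun d => ?_) (fun a b hab => ?_)
  · have := g.dinv_invol d
    simp only [swapDarts_dinv, Equiv.swap_apply_def]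
    grind
  · have key : ∀ d, (g.swapDarts q' r').vert (Equiv.swap x (g.dinv x) d) =
        Equiv.swap (g.vert x) (g.vert (g.dinv x)) ((g.swapDarts q r).vert d) := by
      intro d
      have hu := fun hd => g.eq_or_eq_of_vert_eq (d := d) h1 h1' hd h2 h2' hq
      have hv := fun hd => g.eq_or_eq_of_vert_eq (d := d) h3 h3' hd h4 h4' hr
      simp only [swapDarts_vert, Equiv.swap_apply_def]
      grind
    rw [key, key, hab]

lemma swapDarts_dinv_isIsomorphic (g : CubicGraph n) (q : Fin (6 * n)) :
    (g.swapDarts q (g.dinv q)).IsIsomorphic g := by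
  refine .of_darts (Equiv.swap q (g.dinv q)) (fun d => ?_) (fun a b hab => hab)
  have := g.dinv_invol d
  have := g.dinv_invol q
  simp only [swapDarts_dinv, Equiv.swap_apply_def]
  grind

lemma mem_othersAt {g : CubicGraph n} {x d : Fin (6 * n)} :
    d ∈ g.othersAt x ↔ g.vert d = g.vert x ∧ d ≠ x := by
  simp [othersAt, and_comm]

lemma oMin_mem (g : CubicGraph n) (x : Fin (6 * n)) : g.oMin x ∈ g.othersAt x :=
  Finset.min'_mem _ _

lemma oMax_mem (g : CubicGraph n) (x : Fin (6 * n)) : g.oMax x ∈ g.othersAt x :=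
  Finset.max'_mem _ _

lemma oMin_ne_oMax (g : CubicGraph n) (x : Fin (6 * n)) : g.oMin x ≠ g.oMax x := by
  intro h
  obtain ⟨h1, h2⟩ := mem_othersAt.1 (g.oMin_mem x)
  obtain ⟨y, hy1, hy2, hy3, -⟩ := g.exists_third h1 h2
  have hy : y ∈ g.othersAt x := mem_othersAt.2 ⟨hy3, hy1⟩
  have l1 : g.oMin x ≤ y := Finset.min'_le _ _ hy
  have l2 : y ≤ g.oMax x := Finset.le_max' _ _ hy
  exact hy2 (le_antisymm (h ▸ l2) l1)

lemma eq_oMin_or_oMax {g : CubicGraph n} {x q : Fin (6 * n)} (h : g.vert q = g.vert x)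
    (hq : q ≠ x) : q = g.oMin x ∨ q = g.oMax x := by
  obtain ⟨h1, h2⟩ := mem_othersAt.1 (g.oMin_mem x)
  obtain ⟨h3, h4⟩ := mem_othersAt.1 (g.oMax_mem x)
  have := g.eq_or_eq_of_vert_eq h1 h3 h h2 h4 (g.oMin_ne_oMax x).symm
  tauto

lemma wh_eq_self_or_site (g : CubicGraph n) (i : Fin 2) (x : Fin (6 * n)) :
    g.wh i x = g ∨ ∃ q r, g.Site x q r ∧ g.wh i x = g.swapDarts q r := by
  unfold wh
  obtain ⟨h1, h2⟩ := mem_othersAt.1 (g.oMax_mem x)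
  obtain ⟨h3, h4⟩ := mem_othersAt.1 (g.oMin_mem (g.dinv x))
  obtain ⟨h5, h6⟩ := mem_othersAt.1 (g.oMax_mem (g.dinv x))
  split_ifs with hl hi
  · exact .inl rfl
  · exact .inr ⟨_, _, ⟨h1, h2, h3, h4, hl⟩, rfl⟩
  · exact .inr ⟨_, _, ⟨h1, h2, h5, h6, hl⟩, rfl⟩

lemma Site.exists_wh {g : CubicGraph n} {x q r : Fin (6 * n)} (h : g.Site x q r) :
    ∃ i, (g.wh i x).IsIsomorphic (g.swapDarts q r) := by
  have ⟨h1, h2, h3, h4, h5⟩ := h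
  obtain ⟨a1, a2⟩ := mem_othersAt.1 (g.oMax_mem x)
  obtain ⟨b1, b2⟩ := mem_othersAt.1 (g.oMin_mem (g.dinv x))
  obtain ⟨c1, c2⟩ := mem_othersAt.1 (g.oMax_mem (g.dinv x))
  have hx := g.oMin_ne_oMax x
  have hy := g.oMin_ne_oMax (g.dinv x)
  have hl : ¬ g.IsLoop x := h5
  have e0 : g.wh 0 x = g.swapDarts (g.oMax x) (g.oMin (g.dinv x)) := by simp [wh, hl]
  have e1 : g.wh 1 x = g.swapDarts (g.oMax x) (g.oMax (g.dinv x)) := by simp [wh, hl]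
  have s0 : g.Site x (g.oMax x) (g.oMin (g.dinv x)) := ⟨a1, a2, b1, b2, h5⟩
  have s1 : g.Site x (g.oMax x) (g.oMax (g.dinv x)) := ⟨a1, a2, c1, c2, h5⟩
  rcases eq_oMin_or_oMax h1 h2 with hq | hq <;> rcases eq_oMin_or_oMax h3 h4 with hr | hr
  · exact ⟨1, e1 ▸ s1.swapDarts_isIsomorphic h (hq ▸ hx) (hr ▸ hy)⟩
  · exact ⟨0, e0 ▸ s0.swapDarts_isIsomorphic h (hq ▸ hx) (hr ▸ hy.symm)⟩
  · exact ⟨0, by rw [e0, hq, hr]; exact .refl _⟩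
  · exact ⟨1, by rw [e1, hq, hr]; exact .refl _⟩

lemma Site.symm {g : CubicGraph n} {x q r : Fin (6 * n)} (h : g.Site x q r) :
    (g.swapDarts q r).Site x r q := by
  obtain ⟨h1, h2, h3, h4, h5⟩ := h
  simp only [Site, swapDarts_vert, swapDarts_dinv]
  grind

lemma Site.map {g h : CubicGraph n} (f : Iso g h) {x q r : Fin (6 * n)} (hs : g.Site x q r) :
    h.Site (f.dartEquiv x) (f.dartEquiv q) (f.dartEquiv r) := by
  simpa [Site, f.map_dinv, f.map_vert] using hs

lemma swapDarts_map {g h : CubicGraph n} (f : Iso g h) (q r : Fin (6 * n)) :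
    (g.swapDarts q r).IsIsomorphic (h.swapDarts (f.dartEquiv q) (f.dartEquiv r)) := by
  refine .of_darts f.dartEquiv f.map_dinv (fun a b hab => ?_)
  have key : ∀ d, (h.swapDarts (f.dartEquiv q) (f.dartEquiv r)).vert (f.dartEquiv d) =
      f.vertEquiv ((g.swapDarts q r).vert d) := by
    intro d
    simp only [swapDarts_vert, f.map_vert, f.dartEquiv.injective.eq_iff]
    split_ifs <;> rfl
  rw [key, key, hab]

lemma Reach.symm {g : CubicGraph n} {a b : Fin (6 * n)} (h : g.Reach a b) : g.Reach b a := by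
  induction h with
  | refl => exact .refl
  | tail _ hbc ih =>
    refine .head ?_ ih
    rcases hbc with h | rfl
    · exact .inl h.symm
    · exact .inr (g.dinv_invol _)

lemma Connected.swapDarts {g : CubicGraph n} (hg : g.Connected) {x q r : Fin (6 * n)}
    (hs : g.Site x q r) : (g.swapDarts q r).Connected := by
  obtain ⟨h1, h2, h3, h4, h5⟩ := hs
  set g' := g.swapDarts q r with hg'
  have vx : g'.vert x = g.vert x := by rw [hg', swapDarts_vert]; grind
  have vx' : g'.vert (g.dinv x) = g.vert (g.dinv x) := by rw [hg', swapDarts_vert]; grind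
  have hub : ∀ d, g'.vert d = g.vert x ∨ g'.vert d = g.vert (g.dinv x) → g'.Reach d x := by
    rintro d (hd | hd)
    · exact .single (.inl (hd.trans vx.symm))
    · exact .head (.inl (hd.trans vx'.symm)) (.single (.inr (g.dinv_invol x)))
  intro a b
  induction hg a b with
  | refl => exact .refl
  | @tail b c _ hbc ih =>
    refine ih.trans ?_
    rcases hbc with h | h
    · by_cases hb : g.vert b = g.vert x ∨ g.vert b = g.vert (g.dinv x)
      · refine (hub b ?_).trans (hub c ?_).symm <;> rw [hg', swapDarts_vert] <;> grind
      · refine .single (.inl ?_)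
        rw [hg', swapDarts_vert, swapDarts_vert]; grind
    · exact .single (.inr h)

lemma Connected.wh {g : CubicGraph n} (hg : g.Connected) (i : Fin 2) (x : Fin (6 * n)) :
    (g.wh i x).Connected := by
  rcases g.wh_eq_self_or_site i x with h | ⟨q, r, hs, h⟩ <;> rw [h]
  · exact hg
  · exact hg.swapDarts hs

/-- A Whitehead move on an edge which has no dart in `A`. -/
def MoveOff (A : Set (Fin (6 * n))) (g g' : CubicGraph n) : Prop :=
  ∃ x q r, x ∉ A ∧ g.dinv x ∉ A ∧ g.Site x q r ∧ g' = g.swapDarts q r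

/-- `A` is a union of vertex fibres which is joined to its complement by no edge other than
the edge of the dart `p ∉ A`. -/
structure Pocket (g : CubicGraph n) (A : Set (Fin (6 * n))) (p : Fin (6 * n)) : Prop where
  closed : ∀ a b, g.vert a = g.vert b → a ∈ A → b ∈ A
  root : p ∉ A
  inner : ∀ d, d ∉ A → d ≠ p → g.dinv d ∉ A

/-- The darts `d 0, …, d (m - 1)` form a non-backtracking walk which starts at the vertex of `p`
with a dart other than `p`, visits distinct vertices, and ends at the vertex of `d j`. -/
structure Lasso (g : CubicGraph n) (p : Fin (6 * n)) (m j : ℕ) (d : ℕ → Fin (6 * n)) :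
    Prop where
  start : g.vert (d 0) = g.vert p
  start_ne : d 0 ≠ p
  step : ∀ i, i + 1 < m → g.vert (d (i + 1)) = g.vert (g.dinv (d i))
  step_ne : ∀ i, i + 1 < m → d (i + 1) ≠ g.dinv (d i)
  inj : ∀ i k, i < m → k < m → g.vert (d i) = g.vert (d k) → i = k
  lt : j < m
  close : g.vert (g.dinv (d (m - 1))) = g.vert (d j)

lemma Pocket.of_site {g : CubicGraph n} {A : Set (Fin (6 * n))} {p x q r : Fin (6 * n)}
    (hA : g.Pocket A p) (hs : g.Site x q r) (hx : x ∉ A) (hx' : g.dinv x ∉ A) :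
    (g.swapDarts q r).Pocket A p := by
  have hq : q ∉ A := fun h => hx (hA.closed _ _ hs.1 h)
  have hr : r ∉ A := fun h => hx' (hA.closed _ _ hs.2.2.1 h)
  refine ⟨fun a b hab ha => ?_, hA.root, hA.inner⟩
  have h1 := hA.closed a b
  have h2 := hA.closed a q
  have h3 := hA.closed a r
  simp only [swapDarts_vert] at hab
  grind

lemma exists_lasso (g : CubicGraph n) (p : Fin (6 * n)) :
    ∃ m j d, g.Lasso p m j d := by
  let d : ℕ → Fin (6 * n) := fun i => Nat.rec (g.oMin p) (fun _ e => g.oMin (g.dinv e)) i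
  have h0 := mem_othersAt.1 (g.oMin_mem p)
  have hs := fun i => mem_othersAt.1 (g.oMin_mem (g.dinv (d i)))
  have hex : ∃ k, ∃ i < k, g.vert (d i) = g.vert (d k) := by
    obtain ⟨i, k, hik, h⟩ := Finite.exists_ne_map_eq_of_infinite fun i => g.vert (d i)
    rcases lt_or_gt_of_ne hik with hlt | hlt
    · exact ⟨k, i, hlt, h⟩
    · exact ⟨i, k, hlt, h.symm⟩
  classical
  obtain ⟨j, hj, hjm⟩ := Nat.find_spec hex
  refine ⟨Nat.find hex, j, d, h0.1, h0.2, fun i _ => (hs i).1, fun i _ => (hs i).2, ?_, hj, ?_⟩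
  · intro i k hi hk h
    by_contra hik
    rcases lt_or_gt_of_ne hik with hlt | hlt
    · exact Nat.find_min hex hk ⟨i, hlt, h⟩
    · exact Nat.find_min hex hi ⟨k, hlt, h.symm⟩
  · have := (hs (Nat.find hex - 1)).1
    rw [hjm, ← this]
    obtain ⟨k, hk⟩ : ∃ k, Nat.find hex = k + 1 := ⟨_, (Nat.succ_pred_eq_of_pos (by omega)).symm⟩
    rw [hk]; rfl

/-- Shortening a cycle through the vertex of `p`. -/
lemma Lasso.shorten {g : CubicGraph n} {p e : Fin (6 * n)} {m : ℕ} {d : ℕ → Fin (6 * n)}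
    (h : g.Lasso p m 0 d) (hm : 3 ≤ m) (he : e ≠ d 1) (he' : e ≠ g.dinv (d 0))
    (hv : g.vert e = g.vert (d 1)) :
    g.Site (d 1) e (d 2) ∧
      (g.swapDarts e (d 2)).Lasso p (m - 1) 0 fun i => if i = 0 then d 0 else d (i + 1) := by
  have s0 := h.step 0 (by omega)
  have s1 := h.step 1 (by omega)
  have n1 := h.step_ne 1 (by omega)
  have i01 := h.inj 0 1 (by omega) (by omega)
  have i02 := h.inj 0 2 (by omega) (by omega)
  have i12 := h.inj 1 2 (by omega) (by omega)
  have hp := h.start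
  simp only [zero_add, Nat.reduceAdd] at *
  have w : ∀ i, 2 ≤ i → i + 1 < m →
      (g.swapDarts e (d 2)).vert (d (i + 1)) = g.vert (d (i + 1)) := by
    intro i hi hi'
    have := h.inj (i + 1) 1 hi' (by omega)
    have := h.inj (i + 1) 2 hi' (by omega)
    rw [swapDarts_vert]
    grind
  have w0 : (g.swapDarts e (d 2)).vert (d 0) = g.vert (d 0) := by rw [swapDarts_vert]; grind
  have w2 : (g.swapDarts e (d 2)).vert (d 2) = g.vert (d 1) := by rw [swapDarts_vert]; grind
  have z : ∀ i, 2 ≤ i → i < m →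
      (g.swapDarts e (d 2)).vert (g.dinv (d i)) = g.vert (g.dinv (d i)) := by
    intro i hi hi'
    have : g.vert (g.dinv (d i)) ≠ g.vert (d 1) ∧ g.vert (g.dinv (d i)) ≠ g.vert (d 2) := by
      by_cases hl : i + 1 < m
      · have := h.inj (i + 1) 1 hl (by omega)
        have := h.inj (i + 1) 2 hl (by omega)
        have := h.step i hl
        grind
      · have := h.close
        obtain rfl : i = m - 1 := by omega
        grind
    rw [swapDarts_vert]
    grind
  have z0 : (g.swapDarts e (d 2)).vert (g.dinv (d 0)) = g.vert (d 1) := by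
    rw [swapDarts_vert]; grind
  refine ⟨⟨hv, he, s1, n1, by grind⟩, ⟨?_, h.start_ne, ?_, ?_, ?_, by omega, ?_⟩⟩
  · simp only [if_true]
    rw [w0, swapDarts_vert]; grind
  · rintro (_ | i) hi
    · simp [w2, swapDarts_dinv, z0]
    · simp only [Nat.add_eq_zero_iff, one_ne_zero, and_false, if_false, swapDarts_dinv]
      rw [w _ (by omega) (by omega), z _ (by omega) (by omega)]
      exact h.step _ (by omega)
  · rintro (_ | i) hi
    · simp only [swapDarts_dinv, zero_add, one_ne_zero, if_false, if_true, Nat.reduceAdd]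
      grind
    · simpa [swapDarts_dinv] using h.step_ne (i + 1 + 1) (by omega)
  · have val : ∀ i, i < m - 1 →
        (g.swapDarts e (d 2)).vert (if i = 0 then d 0 else d (i + 1)) =
          g.vert (d (if i = 0 then 0 else if i = 1 then 1 else i + 1)) := by
      intro i hi
      by_cases h0 : i = 0
      · simp [h0, w0]
      · by_cases h1 : i = 1
        · simp [h1, w2]
        · simp only [h0, h1, if_false]
          exact w i (by omega) (by omega)
    intro i k hi hk hik
    simp only [val i hi, val k hk] at hik
    have := h.inj _ _ (by split_ifs <;> omega) (by split_ifs <;> omega) hik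
    split_ifs at this <;> omega
  · have hne : m - 1 - 1 ≠ 0 := by omega
    have heq : m - 1 - 1 + 1 = m - 1 := by omega
    simp only [hne, if_false, if_true, heq, swapDarts_dinv, w0]
    rw [z _ (by omega) (by omega)]
    exact h.close

/-- Sliding `p` towards the cycle of a lasso. -/
lemma Lasso.slide {g : CubicGraph n} {p e : Fin (6 * n)} {m j : ℕ} {d : ℕ → Fin (6 * n)}
    (h : g.Lasso p m j d) (hj : 1 ≤ j) (he : e ≠ d 0) (he' : e ≠ p)
    (hv : g.vert e = g.vert (d 0)) :
    g.Site (d 0) e (d 1) ∧ ∃ m' j' d', (g.swapDarts e (d 1)).Lasso p m' j' d' ∧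
      (m' < m ∨ m' = m ∧ j' = 0) := by
  have hjm := h.lt
  have s0 := h.step 0 (by omega)
  have n0 := h.step_ne 0 (by omega)
  have i01 := h.inj 0 1 (by omega) (by omega)
  have hp := h.start
  simp only [zero_add] at *
  have w1 : (g.swapDarts e (d 1)).vert (d 1) = g.vert (d 0) := by rw [swapDarts_vert]; grind
  have wp : (g.swapDarts e (d 1)).vert p = g.vert (d 0) := by rw [swapDarts_vert]; grind
  have w : ∀ i, 1 ≤ i → i + 1 < m →
      (g.swapDarts e (d 1)).vert (d (i + 1)) = g.vert (d (i + 1)) := by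
    intro i hi hi'
    have := h.inj (i + 1) 1 hi' (by omega)
    have := h.inj (i + 1) 0 hi' (by omega)
    rw [swapDarts_vert]
    grind
  have z : ∀ i, 1 ≤ i → i + 1 < m →
      (g.swapDarts e (d 1)).vert (g.dinv (d i)) = g.vert (g.dinv (d i)) := by
    intro i hi hi'
    have := h.inj (i + 1) 1 hi' (by omega)
    have := h.inj (i + 1) 0 hi' (by omega)
    have := h.step i hi'
    rw [swapDarts_vert]
    grind
  have hc := h.close
  refine ⟨⟨hv, he, s0, n0, by grind⟩, ?_⟩
  have val : ∀ i, i + 1 < m → (g.swapDarts e (d 1)).vert (d (i + 1)) =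
      g.vert (d (if i = 0 then 0 else i + 1)) := by
    intro i hi
    by_cases h0 : i = 0
    · simp [h0, w1]
    · simp only [h0, if_false]
      exact w i (by omega) hi
  by_cases hj1 : j = 1
  · subst hj1
    have hz0 : (g.swapDarts e (d 1)).vert (g.dinv (d 0)) = g.vert (d 1) := by
      rw [swapDarts_vert]; grind
    have hlast : (g.swapDarts e (d 1)).vert (g.dinv (d (m - 1))) = g.vert (d 1) := by
      have : g.dinv (d (m - 1)) ≠ d 1 := by
        intro hd
        by_cases h2 : m = 2
        · subst h2; exact g.dinv_ne _ hd
        · have h12 := h.step 1 (by omega)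
          rw [← hd, g.dinv_invol] at h12
          have := h.inj 2 (m - 1) (by omega) (by omega) h12
          have hn := h.step_ne 1 (by omega)
          rw [← hd, g.dinv_invol] at hn
          exact hn (congrArg d this)
      rw [swapDarts_vert]
      grind
    have hd0 : (g.swapDarts e (d 1)).vert (d 0) = g.vert (d 0) := by
      rw [swapDarts_vert]; grind
    have val' : ∀ i, i < m →
        (g.swapDarts e (d 1)).vert (if i + 1 = m then g.dinv (d 0) else d (i + 1)) =
          g.vert (d (if i + 1 = m then 1 else if i = 0 then 0 else i + 1)) := by
      intro i hi
      by_cases hm : i + 1 = m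
      · simp only [hm, if_true, hz0]
      · simp only [hm, if_false]
        exact val i (by omega)
    refine ⟨m, 0, fun i => if i + 1 = m then g.dinv (d 0) else d (i + 1),
      ⟨?_, ?_, ?_, ?_, ?_, by omega, ?_⟩, .inr ⟨rfl, rfl⟩⟩
    · have : ¬ 0 + 1 = m := by omega
      simp only [this, if_false]
      rw [wp]; exact w1
    · have : ¬ 0 + 1 = m := by omega
      simp only [this, if_false, zero_add]
      grind
    · intro i hi
      have h1 : ¬ i + 1 = m := by omega
      simp only [h1, if_false, swapDarts_dinv]
      rw [val' _ hi]
      by_cases h2 : i + 1 + 1 = m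
      · have h3 : i + 1 = m - 1 := by omega
        rw [if_pos h2, h3, hlast]
      · simp only [h2, if_false, Nat.succ_ne_zero]
        rw [z _ (by omega) (by omega)]
        exact h.step _ (by omega)
    · intro i hi
      have h1 : ¬ i + 1 = m := by omega
      simp only [h1, if_false, swapDarts_dinv]
      split_ifs with h2
      · intro hd
        have := congrArg g.dinv hd
        rw [g.dinv_invol, g.dinv_invol] at this
        have := h.inj 0 (i + 1) (by omega) (by omega) (congrArg g.vert this)
        omega
      · exact h.step_ne _ (by omega)
    · intro i k hi hk hik
      simp only [val' i hi, val' k hk] at hik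
      have := h.inj _ _ (by split_ifs <;> omega) (by split_ifs <;> omega) hik
      split_ifs at this <;> omega
    · have h1 : m - 1 + 1 = m := by omega
      have h2 : ¬ 0 + 1 = m := by omega
      simp only [h1, h2, if_true, if_false, swapDarts_dinv, g.dinv_invol, zero_add, w1, hd0]
  · refine ⟨m - 1, j - 1, fun i => d (i + 1), ⟨?_, ?_, ?_, ?_, ?_, by omega, ?_⟩,
      .inl (by omega)⟩
    · rw [wp]; exact w1
    · simp only [zero_add]
      grind
    · intro i hi
      rw [w _ (by omega) (by omega), swapDarts_dinv, z _ (by omega) (by omega)]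
      exact h.step _ (by omega)
    · intro i hi
      exact h.step_ne _ (by omega)
    · intro i k hi hk hik
      simp only [val i (by omega), val k (by omega)] at hik
      have := h.inj _ _ (by split_ifs <;> omega) (by split_ifs <;> omega) hik
      split_ifs at this <;> omega
    · have h1 : m - 1 - 1 + 1 = m - 1 := by omega
      have h2 : j - 1 + 1 = j := by omega
      have v := val (j - 1) (by omega)
      have hj0 : ¬ j - 1 = 0 := by omega
      simp only [h2, hj0, if_false] at v
      simp only [h1, h2, swapDarts_dinv]
      have := h.inj j 0 hjm (by omega)
      have := h.inj j 1 hjm (by omega)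
      rw [v, swapDarts_vert]
      grind

/-- By moves off `A` two of the edges at the vertex of `p` can be made to share both ends. -/
lemma Lasso.exists_parallel {A : Set (Fin (6 * n))} {p : Fin (6 * n)} (k : ℕ) :
    ∀ (g : CubicGraph n) (m j : ℕ) (d : ℕ → Fin (6 * n)), g.Pocket A p → g.Lasso p m j d →
      2 * m + (if j = 0 then 0 else 1) ≤ k →
      ∃ g', Relation.ReflTransGen (MoveOff A) g g' ∧ g'.Pocket A p ∧ ∃ a b, a ≠ b ∧
        g'.vert a = g'.vert p ∧ g'.vert b = g'.vert p ∧
          g'.vert (g'.dinv a) = g'.vert (g'.dinv b) := by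
  induction k with
  | zero =>
    intro g m j d _ h hk
    have := h.lt
    omega
  | succ k ih =>
    intro g m j d hA h hk
    have hjm := h.lt
    have hd0 : d 0 ∉ A := fun hd => hA.root (hA.closed _ _ h.start hd)
    have hd0' : g.dinv (d 0) ∉ A := hA.inner _ hd0 h.start_ne
    by_cases hj : j = 0
    · subst hj
      rcases (by omega : m = 1 ∨ m = 2 ∨ 3 ≤ m) with rfl | rfl | hm
      · refine ⟨g, .refl, hA, d 0, g.dinv (d 0), (g.dinv_ne _).symm, h.start,
          h.close.trans h.start, ?_⟩
        rw [g.dinv_invol]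
        exact h.close
      · refine ⟨g, .refl, hA, d 0, g.dinv (d 1), ?_, h.start, h.close.trans h.start, ?_⟩
        · intro hd
          apply h.step_ne 0 (by omega)
          rw [hd, g.dinv_invol]
        · rw [g.dinv_invol]
          exact (h.step 0 (by omega)).symm
      · have hs := h.step 0 (by omega)
        have h10 := h.inj 1 0 (by omega) (by omega)
        have hd1 : d 1 ∉ A := fun hd => hd0' (hA.closed _ _ hs hd)
        have hd1' : g.dinv (d 1) ∉ A := by
          refine hA.inner _ hd1 fun hd => ?_
          have := h10 (by rw [h.start, hd])
          omega
        obtain ⟨e, he, he', hv, -⟩ := g.exists_third hs.symm (h.step_ne 0 (by omega)).symm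
        obtain ⟨hsite, hl⟩ := h.shorten hm he he' hv
        obtain ⟨g', hg', hrest⟩ := ih _ _ _ _ (hA.of_site hsite hd1 hd1') hl (by
          simp only [if_true] at hk ⊢; omega)
        exact ⟨g', .head ⟨_, _, _, hd1, hd1', hsite, rfl⟩ hg', hrest⟩
    · obtain ⟨e, he, he', hv, -⟩ := g.exists_third h.start.symm h.start_ne.symm
      obtain ⟨hsite, m', j', d', hl, hlt⟩ := h.slide (by omega) he he' hv
      obtain ⟨g', hg', hrest⟩ := ih _ _ _ _ (hA.of_site hsite hd0 hd0') hl (by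
        simp only [hj, if_false] at hk
        split_ifs <;> omega)
      exact ⟨g', .head ⟨_, _, _, hd0, hd0', hsite, rfl⟩ hg', hrest⟩

lemma Pocket.exists_parallel {g : CubicGraph n} {A : Set (Fin (6 * n))} {p : Fin (6 * n)}
    (hA : g.Pocket A p) :
    ∃ g', Relation.ReflTransGen (MoveOff A) g g' ∧ g'.Pocket A p ∧ ∃ a b, a ≠ b ∧
      g'.vert a = g'.vert p ∧ g'.vert b = g'.vert p ∧
        g'.vert (g'.dinv a) = g'.vert (g'.dinv b) := by
  obtain ⟨m, j, d, h⟩ := g.exists_lasso p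
  exact Lasso.exists_parallel _ g m j d hA h le_rfl

/-- The involution on darts of the one-ended chain which starts with a loop and continues with
alternating single and double edges; the darts `3 * v`, `3 * v + 1`, `3 * v + 2` are based at the
vertex `v`. -/
def chainInv (a : ℕ) : ℕ :=
  if a = 0 then 1 else if a = 1 then 0 else if (a - 2) % 6 = 0 then a + 1
  else if (a - 2) % 6 = 1 then a - 1 else if (a - 2) % 6 ≤ 3 then a + 2 else a - 2

/-- `φ` embeds the first `2 * k + 1` vertices of the chain into `g`. -/
structure Chain (g : CubicGraph n) (k : ℕ) (φ : ℕ → Fin (6 * n)) : Prop where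
  inj : ∀ a b, a < 6 * k + 3 → b < 6 * k + 3 → φ a = φ b → a = b
  vert : ∀ a b, a < 6 * k + 3 → b < 6 * k + 3 → a / 3 = b / 3 → g.vert (φ a) = g.vert (φ b)
  dinv : ∀ a, a < 6 * k + 2 → g.dinv (φ a) = φ (chainInv a)

/-- `φ` identifies `g` with the chain on `2 * n` vertices which ends with a loop. -/
structure FullChain (g : CubicGraph n) (φ : ℕ → Fin (6 * n)) : Prop where
  inj : ∀ a b, a < 6 * n → b < 6 * n → φ a = φ b → a = b
  vert : ∀ a b, a < 6 * n → b < 6 * n → a / 3 = b / 3 → g.vert (φ a) = g.vert (φ b)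
  dinv : ∀ a, a < 6 * n → g.dinv (φ a) =
    φ (if a = 6 * n - 2 then 6 * n - 1 else if a = 6 * n - 1 then 6 * n - 2 else chainInv a)

/-- The darts covered by an initial segment of the chain. -/
def chainDarts (k : ℕ) (φ : ℕ → Fin (6 * n)) : Set (Fin (6 * n)) := {d | ∃ a < 6 * k + 3, φ a = d}

lemma chainInv_lt {k a : ℕ} (h : a < 6 * k + 2) : chainInv a < 6 * k + 2 := by
  unfold chainInv
  split_ifs <;> omega

lemma chainInv_add (k i : ℕ) (hi : i < 6) : chainInv (6 * k + 2 + i) =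
    if i = 0 then 6 * k + 3 else if i = 1 then 6 * k + 2 else if i ≤ 3 then 6 * k + 4 + i
    else 6 * k + i := by
  have : (6 * k + 2 + i - 2) % 6 = i := by omega
  unfold chainInv
  rw [this, if_neg (by omega), if_neg (by omega)]
  split_ifs <;> omega
lemma Chain.closed {g : CubicGraph n} {k : ℕ} {φ : ℕ → Fin (6 * n)} (h : g.Chain k φ)
    (x y : Fin (6 * n)) (hxy : g.vert x = g.vert y) (hx : x ∈ chainDarts k φ) :
    y ∈ chainDarts k φ := by
  obtain ⟨a, ha, rfl⟩ := hx
  have v := fun i (hi : i < 3) => h.vert (3 * (a / 3) + i) a (by omega) ha (by omega)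
  have ne := fun i j (hi : i < 3) (hj : j < 3) (hij : i ≠ j) =>
    mt (h.inj (3 * (a / 3) + i) (3 * (a / 3) + j) (by omega) (by omega)) (by omega)
  rcases g.eq_or_eq_of_vert_eq (x := φ (3 * (a / 3) + 0)) (d := y)
    ((v 1 (by omega)).trans (v 0 (by omega)).symm) ((v 2 (by omega)).trans (v 0 (by omega)).symm)
    (hxy.symm.trans (v 0 (by omega)).symm) (ne 1 0 (by omega) (by omega) (by omega))
    (ne 2 0 (by omega) (by omega) (by omega)) (ne 2 1 (by omega) (by omega) (by omega))
    with rfl | rfl | rfl <;> exact ⟨_, by omega, rfl⟩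

lemma Chain.pocket {g : CubicGraph n} {k : ℕ} {φ : ℕ → Fin (6 * n)} (h : g.Chain k φ) :
    g.Pocket (chainDarts k φ) (g.dinv (φ (6 * k + 2))) := by
  refine ⟨h.closed, ?_, ?_⟩
  · rintro ⟨b, hb, hb'⟩
    have hb2 : g.dinv (φ b) = φ (6 * k + 2) := by rw [hb', g.dinv_invol]
    rcases Nat.lt_succ_iff_lt_or_eq.1 (show b < (6 * k + 2).succ by omega) with hlt | rfl
    · rw [h.dinv b hlt] at hb2
      have h1 := chainInv_lt hlt
      have := h.inj _ _ (by omega) (by omega) hb2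
      omega
    · exact g.dinv_ne _ hb2
  · rintro d hd hdp ⟨b, hb, hb'⟩
    have hd' : d = g.dinv (φ b) := by rw [hb', g.dinv_invol]
    rcases Nat.lt_succ_iff_lt_or_eq.1 (show b < (6 * k + 2).succ by omega) with hlt | rfl
    · have h1 := chainInv_lt hlt
      exact hd ⟨chainInv b, by omega, by rw [hd', h.dinv b hlt]⟩
    · exact hdp hd'

lemma Chain.moveOff {g g' : CubicGraph n} {k : ℕ} {φ : ℕ → Fin (6 * n)} (h : g.Chain k φ)
    (hm : MoveOff (chainDarts k φ) g g') : g'.Chain k φ := by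
  obtain ⟨x, q, r, hx, hx', hs, rfl⟩ := hm
  refine ⟨h.inj, fun a b ha hb hab => ?_, h.dinv⟩
  have hv : ∀ a, a < 6 * k + 3 → (g.swapDarts q r).vert (φ a) = g.vert (φ a) := by
    intro a ha
    have hq : φ a ≠ q := fun e => hx (h.closed _ _ hs.1 ⟨a, ha, e⟩)
    have hr : φ a ≠ r := fun e => hx' (h.closed _ _ hs.2.2.1 ⟨a, ha, e⟩)
    rw [swapDarts_vert, if_neg hq, if_neg hr]
  rw [hv a ha, hv b hb]
  exact h.vert a b ha hb hab

lemma Chain.lt {g : CubicGraph n} {k : ℕ} {φ : ℕ → Fin (6 * n)} (h : g.Chain k φ) : k < n := by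
  have := Finset.card_le_card_of_injOn φ (s := Finset.range (6 * k + 3))
    (t := (Finset.univ : Finset (Fin (6 * n)))) (fun _ _ => by simp) (fun a ha b hb =>
      h.inj a b (by simpa using ha) (by simpa using hb))
  simp at this
  omega

lemma MoveOff.mono {A B : Set (Fin (6 * n))} (hAB : A ⊆ B) {g g' : CubicGraph n}
    (h : MoveOff B g g') : MoveOff A g g' := by
  obtain ⟨x, q, r, hx, hx', h⟩ := h
  exact ⟨x, q, r, fun hA => hx (hAB hA), fun hA => hx' (hAB hA), h⟩

lemma Connected.moveOff {g g' : CubicGraph n} {A : Set (Fin (6 * n))}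
    (h : Relation.ReflTransGen (MoveOff A) g g') (hg : g.Connected) : g'.Connected := by
  induction h with
  | refl => exact hg
  | tail _ hm ih =>
    obtain ⟨x, q, r, -, -, hs, rfl⟩ := hm
    exact ih.swapDarts hs

lemma Connected.eq_univ {g : CubicGraph n} (hg : g.Connected) {C : Set (Fin (6 * n))}
    {c : Fin (6 * n)} (hc : c ∈ C) (hv : ∀ a b, g.vert a = g.vert b → a ∈ C → b ∈ C)
    (hd : ∀ a ∈ C, g.dinv a ∈ C) (d : Fin (6 * n)) : d ∈ C := by
  induction hg c d with
  | refl => exact hc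
  | tail _ h ih =>
    rcases h with h | rfl
    · exact hv _ _ h ih
    · exact hd _ ih

/-- A loop at the end of an initial segment of the chain completes it. -/
lemma Chain.fullChain {g : CubicGraph n} {k : ℕ} {φ : ℕ → Fin (6 * n)} (h : g.Chain k φ)
    (hg : g.Connected) {a : Fin (6 * n)} (ha : g.vert a = g.vert (g.dinv (φ (6 * k + 2))))
    (ha' : g.vert (g.dinv a) = g.vert a) (hap : a ≠ g.dinv (φ (6 * k + 2))) :
    ∃ ψ, g.FullChain ψ := by
  obtain ⟨hclosed, hroot, hinner⟩ := h.pocket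
  set A := chainDarts k φ with hA
  set p := g.dinv (φ (6 * k + 2)) with hp
  have hpd : g.dinv p = φ (6 * k + 2) := by rw [hp, g.dinv_invol]
  have hℓ : φ (6 * k + 2) ∈ A := ⟨_, by omega, rfl⟩
  have haA : a ∉ A := fun m => hroot (hclosed _ _ ha m)
  have haA' : g.dinv a ∉ A := hinner a haA hap
  have hap' : g.dinv a ≠ p := by
    intro e
    rw [← e, g.dinv_invol] at hpd
    exact haA (hpd ▸ hℓ)
  have hda := g.dinv_ne a
  have hφA : ∀ i, i < 6 * k + 3 → φ i ∈ A := fun i hi => ⟨i, hi, rfl⟩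
  let ψ : ℕ → Fin (6 * n) := fun i => if i = 6 * k + 3 then p else if i = 6 * k + 4 then a
    else if i = 6 * k + 5 then g.dinv a else φ i
  have ψ3 : ψ (6 * k + 3) = p := by simp [ψ]
  have ψ4 : ψ (6 * k + 4) = a := by simp [ψ]
  have ψ5 : ψ (6 * k + 5) = g.dinv a := by simp [ψ]
  have ψlt : ∀ i, i < 6 * k + 3 → ψ i = φ i := by
    intro i hi
    simp only [ψ]
    rw [if_neg (by omega), if_neg (by omega), if_neg (by omega)]
  have cases6 : ∀ i, i < 6 * k + 6 →
      i < 6 * k + 3 ∨ i = 6 * k + 3 ∨ i = 6 * k + 4 ∨ i = 6 * k + 5 := by omega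
  have hinj : ∀ i j, i < 6 * k + 6 → j < 6 * k + 6 → ψ i = ψ j → i = j := by
    intro i j hi hj hij
    rcases cases6 i hi with hi | rfl | rfl | rfl <;> rcases cases6 j hj with hj | rfl | rfl | rfl <;>
      (try rw [ψlt i hi] at hij) <;> (try rw [ψlt j hj] at hij) <;>
      (try simp only [ψ3, ψ4, ψ5] at hij) <;> first | rfl | exact h.inj _ _ hi hj hij | skip
    all_goals exfalso
    all_goals first | exact absurd hij ‹_› | exact absurd hij.symm ‹_› | skip
    all_goals first
      | exact hroot (hij ▸ hφA _ ‹_›) | exact hroot (hij.symm ▸ hφA _ ‹_›)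
      | exact haA (hij ▸ hφA _ ‹_›) | exact haA (hij.symm ▸ hφA _ ‹_›)
      | exact haA' (hij ▸ hφA _ ‹_›)
  have hsurj : ∀ d, ∃ i < 6 * k + 6, ψ i = d := by
    refine hg.eq_univ (C := {d | ∃ i < 6 * k + 6, ψ i = d}) ⟨6 * k + 4, by omega, rfl⟩ ?_ ?_
    · rintro _ y hxy ⟨i, hi, rfl⟩
      have hA2 : ∀ y, y ∈ A → ∃ i < 6 * k + 6, ψ i = y := by
        rintro y ⟨j, hj, rfl⟩
        exact ⟨j, by omega, ψlt j hj⟩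
      have hw : g.vert y = g.vert p → ∃ i < 6 * k + 6, ψ i = y := by
        intro hy
        rcases g.eq_or_eq_of_vert_eq ha (ha'.trans ha) hy hap hap' hda with rfl | rfl | rfl
        · exact ⟨_, by omega, ψ3⟩
        · exact ⟨_, by omega, ψ4⟩
        · exact ⟨_, by omega, ψ5⟩
      rcases cases6 i hi with hi | rfl | rfl | rfl
      · exact hA2 y (hclosed _ _ hxy (by rw [ψlt i hi]; exact hφA i hi))
      · exact hw (by rw [← hxy, ψ3])
      · exact hw (by rw [← hxy, ψ4, ha])
      · exact hw (by rw [← hxy, ψ5, ha', ha])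
    · rintro _ ⟨i, hi, rfl⟩
      rcases cases6 i hi with hi | rfl | rfl | rfl
      · rcases Nat.lt_succ_iff_lt_or_eq.1 (show i < (6 * k + 2).succ by omega) with hlt | rfl
        · have := chainInv_lt hlt
          exact ⟨chainInv i, by omega, by rw [ψlt i hi, h.dinv i hlt, ψlt (chainInv i) (by omega)]⟩
        · exact ⟨6 * k + 3, by omega, by rw [ψ3, ψlt (6 * k + 2) (by omega)]⟩
      · exact ⟨6 * k + 2, by omega, by rw [ψ3, hpd, ψlt (6 * k + 2) (by omega)]⟩
      · exact ⟨6 * k + 5, by omega, by rw [ψ4, ψ5]⟩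
      · exact ⟨6 * k + 4, by omega, by rw [ψ5, ψ4, g.dinv_invol]⟩
  have hn : 6 * n = 6 * k + 6 := by
    have himg : (Finset.range (6 * k + 6)).image ψ = Finset.univ := by
      ext d
      simpa using hsurj d
    have := Finset.card_image_of_injOn (s := Finset.range (6 * k + 6)) (f := ψ)
      (fun i hi j hj => hinj i j (by simpa using hi) (by simpa using hj))
    rw [himg] at this
    simpa using this
  refine ⟨ψ, fun i j hi hj => hinj i j (by omega) (by omega), fun i j hi hj hij => ?_,
    fun i hi => ?_⟩
  · have hw : ∀ i, 6 * k + 3 ≤ i → i < 6 * k + 6 → g.vert (ψ i) = g.vert p := by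
      intro i hi hi'
      rcases cases6 i hi' with hi | rfl | rfl | rfl
      · omega
      · rw [ψ3]
      · rw [ψ4, ha]
      · rw [ψ5, ha', ha]
    by_cases hi3 : i < 6 * k + 3
    · have hj3 : j < 6 * k + 3 := by omega
      rw [ψlt i hi3, ψlt j hj3]
      exact h.vert i j hi3 hj3 hij
    · rw [hw i (by omega) (by omega), hw j (by omega) (by omega)]
  · rcases cases6 i (by omega) with hi | rfl | rfl | rfl
    · rw [if_neg (by omega), if_neg (by omega), ψlt i hi]
      rcases Nat.lt_succ_iff_lt_or_eq.1 (show i < (6 * k + 2).succ by omega) with hlt | rfl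
      · have := chainInv_lt hlt
        rw [h.dinv i hlt, ψlt (chainInv i) (by omega)]
      · have : chainInv (6 * k + 2) = 6 * k + 3 :=
        chainInv_add k 0 (by omega)
        rw [this, ψ3]
    · have : chainInv (6 * k + 3) = 6 * k + 2 :=
        chainInv_add k 1 (by omega)
      rw [if_neg (by omega), if_neg (by omega), this, ψ3, hpd, ψlt (6 * k + 2) (by omega)]
    · rw [if_pos (by omega), show 6 * n - 1 = 6 * k + 5 by omega, ψ4, ψ5]
    · rw [if_neg (by omega), if_pos (by omega), show 6 * n - 2 = 6 * k + 4 by omega, ψ4, ψ5,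
        g.dinv_invol]

/-- A double edge at the end of an initial segment of the chain extends it. -/
lemma Chain.extend {g : CubicGraph n} {k : ℕ} {φ : ℕ → Fin (6 * n)} (h : g.Chain k φ)
    {a b : Fin (6 * n)} (hab : a ≠ b) (ha : g.vert a = g.vert (g.dinv (φ (6 * k + 2))))
    (hb : g.vert b = g.vert (g.dinv (φ (6 * k + 2))))
    (hpar : g.vert (g.dinv a) = g.vert (g.dinv b)) (hne : g.vert (g.dinv a) ≠ g.vert a)
    (hap : a ≠ g.dinv (φ (6 * k + 2))) (hbp : b ≠ g.dinv (φ (6 * k + 2))) :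
    ∃ ψ, g.Chain (k + 1) ψ := by
  obtain ⟨hclosed, hroot, hinner⟩ := h.pocket
  set A := chainDarts k φ with hA
  set p := g.dinv (φ (6 * k + 2)) with hp
  have hpd : g.dinv p = φ (6 * k + 2) := by rw [hp, g.dinv_invol]
  have haA : a ∉ A := fun m => hroot (hclosed _ _ ha m)
  have haA' : g.dinv a ∉ A := hinner a haA hap
  have hbA : b ∉ A := fun m => hroot (hclosed _ _ hb m)
  have hbA' : g.dinv b ∉ A := hinner b hbA hbp
  have hab' : g.dinv b ≠ g.dinv a := fun e => hab <| by
    rw [← g.dinv_invol a, ← e, g.dinv_invol]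
  obtain ⟨c, hc1, hc2, hc3, -⟩ := g.exists_third hpar.symm hab'
  have hcA : c ∉ A := fun m => haA' (hclosed _ _ hc3 m)
  have hφA : ∀ i, i < 6 * k + 3 → φ i ∈ A := fun i hi => ⟨i, hi, rfl⟩
  let new : ℕ → Fin (6 * n) := fun i => if i = 0 then p else if i = 1 then a
    else if i = 2 then b else if i = 3 then g.dinv a else if i = 4 then g.dinv b else c
  have newA : ∀ i, new i ∉ A := by
    intro i
    simp only [new]
    split_ifs <;> assumption
  have newinj : ∀ i j, i < 6 → j < 6 → new i = new j → i = j := by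
    intro i j hi hj hij
    simp only [new] at hij
    interval_cases i <;> interval_cases j <;> simp at hij ⊢ <;> grind
  have newv : ∀ i, i < 6 → g.vert (new i) = if i < 3 then g.vert p else g.vert (g.dinv a) := by
    intro i hi
    simp only [new]
    interval_cases i <;> simp <;> grind
  let ψ : ℕ → Fin (6 * n) := fun i => if i < 6 * k + 3 then φ i else new (i - (6 * k + 3))
  have ψlt : ∀ i, i < 6 * k + 3 → ψ i = φ i := fun i hi => if_pos hi
  have ψge : ∀ i, 6 * k + 3 ≤ i → ψ i = new (i - (6 * k + 3)) := fun i hi => if_neg (by omega)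
  refine ⟨ψ, fun i j hi hj hij => ?_, fun i j hi hj hij => ?_, fun i hi => ?_⟩
  · by_cases hi' : i < 6 * k + 3 <;> by_cases hj' : j < 6 * k + 3
    · rw [ψlt i hi', ψlt j hj'] at hij
      exact h.inj i j hi' hj' hij
    · rw [ψlt i hi', ψge j (by omega)] at hij
      exact absurd (hij ▸ hφA i hi') (newA _)
    · rw [ψlt j hj', ψge i (by omega)] at hij
      exact absurd (hij ▸ hφA j hj') (newA _)
    · rw [ψge i (by omega), ψge j (by omega)] at hij
      have := newinj _ _ (by omega) (by omega) hij
      omega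
  · by_cases hi' : i < 6 * k + 3
    · rw [ψlt i hi', ψlt j (by omega)]
      exact h.vert i j hi' (by omega) hij
    · rw [ψge i (by omega), ψge j (by omega), newv _ (by omega), newv _ (by omega)]
      split_ifs <;> first | rfl | omega
  · have hcases : i < 6 * k + 2 ∨ i = 6 * k + 2 ∨ i = 6 * k + 3 ∨ i = 6 * k + 4 ∨ i = 6 * k + 5 ∨
      i = 6 * k + 6 ∨ i = 6 * k + 7 := by omega
    rcases hcases with hlt | rfl | rfl | rfl | rfl | rfl | rfl
    · have := chainInv_lt hlt
      rw [ψlt i (by omega), h.dinv i hlt, ψlt (chainInv i) (by omega)]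
    · have e : chainInv (6 * k + 2) = 6 * k + 3 :=
        chainInv_add k 0 (by omega)
      rw [e, ψlt (6 * k + 2) (by omega), ψge (6 * k + 3) (by omega)]
      simp [new, hp]
    · have e : chainInv (6 * k + 3) = 6 * k + 2 :=
        chainInv_add k 1 (by omega)
      rw [e, ψlt (6 * k + 2) (by omega), ψge (6 * k + 3) (by omega)]
      simp [new, hpd]
    · have e : chainInv (6 * k + 4) = 6 * k + 6 :=
        chainInv_add k 2 (by omega)
      rw [e, ψge (6 * k + 4) (by omega), ψge (6 * k + 6) (by omega)]
      simp [new, show 6 * k + 4 - (6 * k + 3) = 1 by omega, show 6 * k + 6 - (6 * k + 3) = 3 by omega]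
    · have e : chainInv (6 * k + 5) = 6 * k + 7 :=
        chainInv_add k 3 (by omega)
      rw [e, ψge (6 * k + 5) (by omega), ψge (6 * k + 7) (by omega)]
      simp [new, show 6 * k + 5 - (6 * k + 3) = 2 by omega, show 6 * k + 7 - (6 * k + 3) = 4 by omega]
    · have e : chainInv (6 * k + 6) = 6 * k + 4 :=
        chainInv_add k 4 (by omega)
      rw [e, ψge (6 * k + 6) (by omega), ψge (6 * k + 4) (by omega)]
      simp [new, show 6 * k + 4 - (6 * k + 3) = 1 by omega, show 6 * k + 6 - (6 * k + 3) = 3 by omega,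
        g.dinv_invol]
    · have e : chainInv (6 * k + 7) = 6 * k + 5 :=
        chainInv_add k 5 (by omega)
      rw [e, ψge (6 * k + 7) (by omega), ψge (6 * k + 5) (by omega)]
      simp [new, show 6 * k + 5 - (6 * k + 3) = 2 by omega, show 6 * k + 7 - (6 * k + 3) = 4 by omega,
        g.dinv_invol]

lemma Chain.exists_fullChain (m : ℕ) : ∀ (g : CubicGraph n) (k : ℕ) (φ : ℕ → Fin (6 * n)),
    g.Chain k φ → g.Connected → n ≤ m + k →
    ∃ g', Relation.ReflTransGen (MoveOff ∅) g g' ∧ ∃ ψ, g'.FullChain ψ := by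
  induction m with
  | zero =>
    intro g k φ h _ hm
    have := h.lt
    omega
  | succ m ih =>
    intro g k φ h hg hm
    obtain ⟨g₁, hmove, hpocket, a, b, hab, ha, hb, hpar⟩ := h.pocket.exists_parallel
    have hdinv : ∀ d, g₁.dinv d = g.dinv d := by
      clear hpocket ha hb hpar
      induction hmove with
      | refl => exact fun _ => rfl
      | tail _ hm ih =>
        obtain ⟨x, q, r, -, -, -, rfl⟩ := hm
        exact ih
    have h₁ : g₁.Chain k φ := by
      clear hpocket ha hb hpar hdinv
      induction hmove with
      | refl => exact h
      | tail _ hm ih => exact ih.moveOff hm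
    have hg₁ := hg.moveOff hmove
    have hmove' : Relation.ReflTransGen (MoveOff ∅) g g₁ :=
      Relation.ReflTransGen.mono (fun _ _ => MoveOff.mono (Set.empty_subset _)) _ _ hmove
    rw [← hdinv] at ha hb hpocket
    obtain ⟨hclosed, hroot, hinner⟩ := hpocket
    set p := g₁.dinv (φ (6 * k + 2)) with hp
    have hpd : g₁.dinv p = φ (6 * k + 2) := by rw [hp, g₁.dinv_invol]
    have hpA : g₁.dinv p ∈ chainDarts k φ := hpd ▸ ⟨_, by omega, rfl⟩
    have root_of : ∀ c, g₁.vert c = g₁.vert p → g₁.vert (g₁.dinv c) = g₁.vert (g₁.dinv p) →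
        c = p := by
      intro c hc hc'
      by_contra hcp
      exact hinner c (fun m => hroot (hclosed _ _ hc m)) hcp (hclosed _ _ hc'.symm hpA)
    have hap : a ≠ p := by
      rintro rfl
      exact hab (root_of b hb hpar.symm).symm
    have hbp : b ≠ p := by
      rintro rfl
      exact hab (root_of a ha hpar)
    by_cases hloop : g₁.vert (g₁.dinv a) = g₁.vert a
    · exact ⟨g₁, hmove', h₁.fullChain hg₁ ha hloop hap⟩
    · obtain ⟨ψ, hψ⟩ := h₁.extend hab ha hb hpar hloop hap hbp
      obtain ⟨g₂, hm₂, hfull⟩ := ih g₁ (k + 1) ψ hψ hg₁ (by omega)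
      exact ⟨g₂, hmove'.trans hm₂, hfull⟩

lemma chain_zero {g : CubicGraph n} {a c : Fin (6 * n)} (ha : g.vert (g.dinv a) = g.vert a)
    (hc : g.vert c = g.vert a) (hca : c ≠ a) (hca' : c ≠ g.dinv a) : ∃ φ, g.Chain 0 φ := by
  have hd := g.dinv_ne a
  have hi := g.dinv_invol a
  refine ⟨fun i => if i = 0 then a else if i = 1 then g.dinv a else c, ?_, ?_, ?_⟩
  · intro i j hi hj hij
    simp only [mul_zero, zero_add] at hi hj
    interval_cases i <;> interval_cases j <;> simp at hij ⊢ <;> grind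
  · intro i j hi hj _
    simp only [mul_zero, zero_add] at hi hj
    interval_cases i <;> interval_cases j <;> simp <;> grind
  · intro i hi
    simp only [mul_zero, zero_add] at hi
    interval_cases i <;> simp [chainInv, g.dinv_invol]

lemma exists_chain_zero (hn : 1 ≤ n) (g : CubicGraph n) :
    ∃ g', Relation.ReflTransGen (MoveOff ∅) g g' ∧ ∃ φ, g'.Chain 0 φ := by
  have hA : g.Pocket ∅ ⟨0, by omega⟩ := ⟨by simp, by simp, by simp⟩
  obtain ⟨g₁, hmove, -, a, b, hab, ha, hb, hpar⟩ := hA.exists_parallel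
  have hba := hb.trans ha.symm
  by_cases hloop : g₁.vert (g₁.dinv a) = g₁.vert a
  · obtain ⟨c, hc1, hc2, hc3, -⟩ := g₁.exists_third hloop (g₁.dinv_ne a)
    exact ⟨g₁, hmove, chain_zero hloop hc3 hc1 hc2⟩
  · have hab' : g₁.dinv b ≠ g₁.dinv a := fun e => hab <| by
      rw [← g₁.dinv_invol a, ← e, g₁.dinv_invol]
    obtain ⟨c, hc1, hc2, hc3, -⟩ := g₁.exists_third hpar.symm hab'
    have hs : g₁.Site a b c := ⟨hba, hab.symm, hc3, hc1, hloop⟩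
    refine ⟨_, hmove.tail ⟨a, b, c, by simp, by simp, hs, rfl⟩,
      chain_zero (a := b) (c := g₁.dinv a) ?_ ?_ ?_ ?_⟩
    · have := g₁.dinv_ne b
      simp only [swapDarts_vert, swapDarts_dinv]
      grind
    · simp only [swapDarts_vert]
      grind
    · grind
    · exact hab'.symm

lemma FullChain.bijective {g : CubicGraph n} {φ : ℕ → Fin (6 * n)} (h : g.FullChain φ) :
    Function.Bijective fun i : Fin (6 * n) => φ i :=
  Finite.injective_iff_bijective.1 fun i j hij => Fin.ext (h.inj i j i.2 j.2 hij)

lemma FullChain.div_eq {g : CubicGraph n} {φ : ℕ → Fin (6 * n)} (h : g.FullChain φ) {i j : ℕ}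
    (hi : i < 6 * n) (hj : j < 6 * n) (hij : g.vert (φ i) = g.vert (φ j)) : i / 3 = j / 3 := by
  have v := fun t (ht : t < 3) => h.vert (3 * (i / 3) + t) i (by omega) hi (by omega)
  have ne := fun s t (hs : s < 3) (ht : t < 3) (hst : s ≠ t) =>
    mt (h.inj (3 * (i / 3) + s) (3 * (i / 3) + t) (by omega) (by omega)) (by omega)
  rcases g.eq_or_eq_of_vert_eq (x := φ (3 * (i / 3) + 0)) (d := φ j)
    ((v 1 (by omega)).trans (v 0 (by omega)).symm) ((v 2 (by omega)).trans (v 0 (by omega)).symm)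
    (hij.symm.trans (v 0 (by omega)).symm) (ne 1 0 (by omega) (by omega) (by omega))
    (ne 2 0 (by omega) (by omega) (by omega)) (ne 2 1 (by omega) (by omega) (by omega))
    with e | e | e <;> have := h.inj _ _ hj (by omega) e <;> omega

lemma FullChain.isIsomorphic {g h : CubicGraph n} {φ ψ : ℕ → Fin (6 * n)} (hg : g.FullChain φ)
    (hh : h.FullChain ψ) : g.IsIsomorphic h := by
  let e := Equiv.ofBijective _ hg.bijective
  let f := Equiv.ofBijective _ hh.bijective
  have key : ∀ i : Fin (6 * n), (e.symm.trans f) (φ i) = ψ i := by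
    intro i
    have : e.symm (φ i) = i := e.symm_apply_apply i
    simp only [Equiv.trans_apply, this]
    rfl
  refine .of_darts (e.symm.trans f) (fun d => ?_) (fun a b hab => ?_)
  · obtain ⟨i, rfl⟩ := hg.bijective.2 d
    simp only
    rw [key, hh.dinv _ i.2, hg.dinv _ i.2]
    have hlt : (if (i : ℕ) = 6 * n - 2 then 6 * n - 1 else if (i : ℕ) = 6 * n - 1 then 6 * n - 2
        else chainInv i) < 6 * n := by
      have := i.2
      unfold chainInv
      split_ifs <;> omega
    exact (key ⟨_, hlt⟩).symm
  · obtain ⟨i, rfl⟩ := hg.bijective.2 a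
    obtain ⟨j, rfl⟩ := hg.bijective.2 b
    simp only
    rw [key, key]
    exact hh.vert _ _ i.2 j.2 (hg.div_eq i.2 j.2 hab)

end CubicGraph

/-- The class of a connected cubic graph. -/
def toClass {n : ℕ} (g : CubicGraph n) (hg : g.Connected) : GammaV n := Quot.mk _ ⟨g, hg⟩

lemma cgIso_equivalence (n : ℕ) : Equivalence (@cgIso n) :=
  ⟨fun g => .refl g.1, fun h => CubicGraph.IsIsomorphic.symm h,
    fun h h' => CubicGraph.IsIsomorphic.trans h h'⟩

lemma toClass_eq_iff {n : ℕ} {g h : CubicGraph n} (hg : g.Connected) (hh : h.Connected) :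
    toClass g hg = toClass h hh ↔ g.IsIsomorphic h := by
  unfold toClass
  rw [Quot.eq, (cgIso_equivalence n).eqvGen_iff]
  rfl

lemma toClass_out {n : ℕ} (u : GammaV n) : toClass (Quot.out u).1 (Quot.out u).2 = u :=
  Quot.out_eq u

lemma out_toClass_isIsomorphic {n : ℕ} {g : CubicGraph n} (hg : g.Connected) :
    (Quot.out (toClass g hg)).1.IsIsomorphic g :=
  (toClass_eq_iff (Quot.out (toClass g hg)).2 hg).1 (toClass_out _)

/-- The edge relation of `Γ_n`. -/
def GammaAdj {n : ℕ} (a b : GammaV n) : Prop :=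
  ∃ (i : Fin 2) (x : Fin (6 * n)),
    CubicGraph.IsIsomorphic ((Quot.out a).1.wh i x) (Quot.out b).1

lemma CubicGraph.Site.gammaAdj {n : ℕ} {g : CubicGraph n} {x q r : Fin (6 * n)}
    (hg : g.Connected) (hs : g.Site x q r) :
    GammaAdj (toClass g hg) (toClass (g.swapDarts q r) (hg.swapDarts hs)) := by
  obtain ⟨f⟩ := (out_toClass_isIsomorphic hg).symm
  obtain ⟨i, hi⟩ := (hs.map f).exists_wh
  exact ⟨i, _, hi.trans ((CubicGraph.swapDarts_map f q r).symm.trans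
    (out_toClass_isIsomorphic _).symm)⟩

lemma CubicGraph.MoveOff.gammaAdj {n : ℕ} {g g' : CubicGraph n} (hg : g.Connected)
    (hg' : g'.Connected) (hm : CubicGraph.MoveOff ∅ g g') :
    GammaAdj (toClass g hg) (toClass g' hg') ∧ GammaAdj (toClass g' hg') (toClass g hg) := by
  obtain ⟨x, q, r, -, -, hs, rfl⟩ := hm
  refine ⟨hs.gammaAdj hg, ?_⟩
  have := hs.symm.gammaAdj hg'
  simpa only [CubicGraph.swapDarts_swapDarts] using this

lemma CubicGraph.Connected.gamma_reachable {n : ℕ} {g g' : CubicGraph n} (hg : g.Connected)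
    (hg' : g'.Connected) (hm : Relation.ReflTransGen (CubicGraph.MoveOff ∅) g g') :
    Relation.ReflTransGen GammaAdj (toClass g hg) (toClass g' hg') ∧
      Relation.ReflTransGen GammaAdj (toClass g' hg') (toClass g hg) := by
  induction hm with
  | refl => exact ⟨.refl, .refl⟩
  | tail hab hm ih =>
    have hb := hg.moveOff hab
    have hadj := hm.gammaAdj hb hg'
    exact ⟨(ih hb).1.tail hadj.1, (ih hb).2.head hadj.2⟩

lemma CubicGraph.Connected.exists_fullChain {n : ℕ} (hn : 1 ≤ n) {g : CubicGraph n}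
    (hg : g.Connected) : ∃ g', Relation.ReflTransGen (CubicGraph.MoveOff ∅) g g' ∧
      ∃ φ, g'.FullChain φ := by
  obtain ⟨g₁, h₁, φ, hφ⟩ := CubicGraph.exists_chain_zero hn g
  obtain ⟨g₂, h₂, h⟩ := CubicGraph.Chain.exists_fullChain n g₁ 0 φ hφ (hg.moveOff h₁) le_rfl
  exact ⟨g₂, h₁.trans h₂, h⟩

theorem gamma_strongly_connected {n : ℕ} (hn : 1 ≤ n) (u v : GammaV n) :
    Relation.ReflTransGen GammaAdj u v := by
  rw [← toClass_out u, ← toClass_out v]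
  have hu := (Quot.out u).2
  have hv := (Quot.out v).2
  obtain ⟨g, hug, φ, hφ⟩ := hu.exists_fullChain hn
  obtain ⟨h, hvh, ψ, hψ⟩ := hv.exists_fullChain hn
  have hg := hu.moveOff hug
  have hh := hv.moveOff hvh
  have e : toClass g hg = toClass h hh := (toClass_eq_iff hg hh).2 (hφ.isIsomorphic hψ)
  exact (hu.gamma_reachable hg hug).1.trans (e ▸ (hv.gamma_reachable hh hvh).2)

namespace CubicGraph

variable {n : ℕ}

/-- The three darts at `w` lead to pairwise different vertices. -/
def Spread (g : CubicGraph n) (w : Fin (2 * n)) : Prop :=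
  ∀ a b, g.vert a = w → g.vert b = w → g.vert (g.dinv a) = g.vert (g.dinv b) → a = b

lemma Spread.map {g h : CubicGraph n} (f : Iso g h) {w : Fin (2 * n)} (hw : g.Spread w) :
    h.Spread (f.vertEquiv w) := by
  intro a b ha hb hab
  obtain ⟨a, rfl⟩ := f.dartEquiv.surjective a
  obtain ⟨b, rfl⟩ := f.dartEquiv.surjective b
  simp only [f.map_vert, f.map_dinv, f.vertEquiv.injective.eq_iff] at ha hb hab
  rw [hw a b ha hb hab]

/-- A move on an edge away from `w` and its neighbours preserves `Spread w`. -/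
lemma Spread.swapDarts {g : CubicGraph n} {w : Fin (2 * n)} (hw : g.Spread w)
    {x q r : Fin (6 * n)} (hs : g.Site x q r)
    (hx : ¬ (g.vert x = w ∨ ∃ d, g.vert d = w ∧ g.vert x = g.vert (g.dinv d)))
    (hx' : ¬ (g.vert (g.dinv x) = w ∨
      ∃ d, g.vert d = w ∧ g.vert (g.dinv x) = g.vert (g.dinv d))) :
    (g.swapDarts q r).Spread w := by
  obtain ⟨h1, h2, h3, h4, h5⟩ := hs
  push Not at hx hx'
  intro a b ha hb hab
  simp only [swapDarts_vert, swapDarts_dinv] at ha hb hab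
  have ha' : g.vert a = w := by grind
  have hb' : g.vert b = w := by grind
  refine hw a b ha' hb' ?_
  have := hx.2 a ha'
  have := hx.2 b hb'
  have := hx'.2 a ha'
  have := hx'.2 b hb'
  grind

lemma Site.spread {g : CubicGraph n} {x q r p : Fin (6 * n)} (hs : g.Site x q r)
    (hp : g.vert p = g.vert x) (hpx : p ≠ x) (hpq : p ≠ q)
    (h1 : g.vert (g.dinv p) ≠ g.vert x) (h2 : g.vert (g.dinv p) ≠ g.vert (g.dinv x))
    (h3 : g.vert (g.dinv p) ≠ g.vert (g.dinv r)) (h4 : g.vert (g.dinv r) ≠ g.vert x)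
    (h5 : g.vert (g.dinv r) ≠ g.vert (g.dinv x)) : (g.swapDarts q r).Spread (g.vert x) := by
  obtain ⟨s1, s2, s3, s4, s5⟩ := hs
  have key : ∀ d, (g.swapDarts q r).vert d = g.vert x → d = x ∨ d = p ∨ d = r := by
    intro d hd
    have := fun e => g.eq_or_eq_of_vert_eq (d := d) s1 hp e s2 hpx hpq
    rw [swapDarts_vert] at hd
    grind
  have tx : (g.swapDarts q r).vert (g.dinv x) = g.vert (g.dinv x) := by
    rw [swapDarts_vert]; grind
  have tp : (g.swapDarts q r).vert (g.dinv p) = g.vert (g.dinv p) := by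
    rw [swapDarts_vert]; grind
  have tr : (g.swapDarts q r).vert (g.dinv r) = g.vert (g.dinv r) := by
    rw [swapDarts_vert]; grind
  intro a b ha hb hab
  simp only [swapDarts_dinv] at hab
  rcases key a ha with rfl | rfl | rfl <;> rcases key b hb with rfl | rfl | rfl <;> grind

lemma Site.flip {g : CubicGraph n} {x q r : Fin (6 * n)} (h : g.Site x q r) :
    g.Site (g.dinv x) r q := by
  obtain ⟨h1, h2, h3, h4, h5⟩ := h
  simp only [Site, g.dinv_invol]
  grind

lemma swapDarts_comm (g : CubicGraph n) (q r : Fin (6 * n)) :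
    g.swapDarts q r = g.swapDarts r q := by
  simp [swapDarts, Equiv.swap_comm q r]

/-- The dart involution of the necklace: the darts with last coordinate `0` belong to single
edges, which join consecutive pairs of vertices, the others to double edges. -/
def necklaceInv (n : ℕ) (d : ZMod n × Bool × Fin 3) : ZMod n × Bool × Fin 3 :=
  (if d.2.2 = 0 then (if d.2.1 then d.1 + 1 else d.1 - 1) else d.1, !d.2.1, d.2.2)

section Necklace

variable [NeZero n]

/-- A numbering of the darts of the necklace. -/
noncomputable def necklaceDart (n : ℕ) [NeZero n] : (ZMod n × Bool × Fin 3) ≃ Fin (6 * n) :=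
  Fintype.equivFinOfCardEq (by simp [ZMod.card]; ring)

/-- A numbering of the vertices of the necklace. -/
noncomputable def necklaceVert (n : ℕ) [NeZero n] : (ZMod n × Bool) ≃ Fin (2 * n) :=
  Fintype.equivFinOfCardEq (by simp [ZMod.card]; ring)

/-- The necklace: `n` double edges joined cyclically by single edges. -/
noncomputable def necklace (n : ℕ) [NeZero n] : CubicGraph n where
  vert d := necklaceVert n (((necklaceDart n).symm d).1, ((necklaceDart n).symm d).2.1)
  dinv d := necklaceDart n (necklaceInv n ((necklaceDart n).symm d))
  dinv_invol d := by
    rw [← Equiv.eq_symm_apply, Equiv.symm_apply_apply]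
    obtain ⟨j, s, c⟩ := (necklaceDart n).symm d
    cases s <;> by_cases hc : c = 0 <;> simp [necklaceInv, hc]
  dinv_ne d := by
    rw [Ne, ← Equiv.eq_symm_apply]
    obtain ⟨j, s, c⟩ := (necklaceDart n).symm d
    simp [necklaceInv]
  regular v := by
    obtain ⟨⟨j, s⟩, rfl⟩ := (necklaceVert n).surjective v
    have : (Finset.univ.filter fun d => necklaceVert n (((necklaceDart n).symm d).1,
        ((necklaceDart n).symm d).2.1) = necklaceVert n (j, s)) =
        (Finset.univ : Finset (Fin 3)).image fun c => necklaceDart n (j, s, c) := by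
      ext d
      obtain ⟨⟨j', s', c⟩, rfl⟩ := (necklaceDart n).surjective d
      simp [eq_comm]
    rw [this, Finset.card_image_of_injective _ (fun a b h => by simpa using h)]
    simp

lemma necklace_vert (j : ZMod n) (s : Bool) (c : Fin 3) :
    (necklace n).vert (necklaceDart n (j, s, c)) = necklaceVert n (j, s) := by
  simp [necklace]

lemma necklace_dinv (d : ZMod n × Bool × Fin 3) :
    (necklace n).dinv (necklaceDart n d) = necklaceDart n (necklaceInv n d) := by
  simp [necklace]

lemma necklace_connected : (necklace n).Connected := by
  have h0 : ∀ k : ℕ, (necklace n).Reach (necklaceDart n (0, false, 0))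
      (necklaceDart n (k, false, 0)) := by
    intro k
    induction k with
    | zero => rw [Nat.cast_zero]; exact .refl
    | succ k ih =>
      refine ((ih.tail (b := necklaceDart n (k, false, 0)) (c := necklaceDart n (k, false, 1))
        (.inl ?_)).tail (c := necklaceDart n (k, true, 1)) (.inr ?_)).tail
        (b := necklaceDart n (k, true, 1)) (c := necklaceDart n (k, true, 0)) (.inl ?_) |>.tail
        (.inr ?_)
      all_goals simp [necklace_vert, necklace_dinv, necklaceInv]
  have h1 : ∀ d, (necklace n).Reach (necklaceDart n (0, false, 0)) d := by
    intro d
    obtain ⟨⟨j, s, c⟩, rfl⟩ := (necklaceDart n).surjective d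
    have hj := h0 j.val
    rw [ZMod.natCast_zmod_val] at hj
    cases s
    · exact hj.tail (.inl (by simp [necklace_vert]))
    · refine ((hj.tail (c := necklaceDart n (j, false, 1)) (.inl ?_)).tail
        (c := necklaceDart n (j, true, 1)) (.inr ?_)).tail (.inl ?_)
      all_goals simp [necklace_vert, necklace_dinv, necklaceInv]
  exact fun d d' => (h1 d).symm.trans (h1 d')

/-- Rotation of the necklace. -/
lemma necklace_rotation (k : ZMod n) : ∃ f : Iso (necklace n) (necklace n), ∀ d,
    f.dartEquiv (necklaceDart n d) = necklaceDart n (d.1 + k, d.2) := by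
  refine ⟨⟨(necklaceDart n).symm.trans (((Equiv.addRight k).prodCongr (Equiv.refl _)).trans
    (necklaceDart n)), (necklaceVert n).symm.trans
    (((Equiv.addRight k).prodCongr (Equiv.refl _)).trans (necklaceVert n)), ?_, ?_⟩, ?_⟩
  · intro d
    obtain ⟨⟨j, s, c⟩, rfl⟩ := (necklaceDart n).surjective d
    simp only [necklace_dinv, Equiv.trans_apply, Equiv.symm_apply_apply]
    simp [necklaceInv]
    split_ifs <;> ring
  · intro d
    obtain ⟨⟨j, s, c⟩, rfl⟩ := (necklaceDart n).surjective d
    simp [necklace_vert]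
  · rintro ⟨j, s, c⟩
    simp

lemma necklace_not_spread (w : Fin (2 * n)) : ¬ (necklace n).Spread w := by
  intro h
  obtain ⟨⟨j, s⟩, rfl⟩ := (necklaceVert n).surjective w
  have := h (necklaceDart n (j, s, 1)) (necklaceDart n (j, s, 2)) (necklace_vert _ _ _)
    (necklace_vert _ _ _) (by simp [necklace_dinv, necklaceInv, necklace_vert])
  simp at this

variable [Fact (1 < n)]

/-- A move on a single edge of the necklace creates a vertex with three different neighbours. -/
lemma necklace_spread_of_single {j : ZMod n} {s : Bool} {q r : Fin (6 * n)}
    (hs : (necklace n).Site (necklaceDart n (j, s, 0)) q r) :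
    ∃ w, ((necklace n).swapDarts q r).Spread w := by
  have hs' := hs
  obtain ⟨⟨jq, sq, cq⟩, rfl⟩ := (necklaceDart n).surjective q
  obtain ⟨⟨jr, sr, cr⟩, rfl⟩ := (necklaceDart n).surjective r
  simp only [Site, necklace_vert, necklace_dinv, necklaceInv, EmbeddingLike.apply_eq_iff_eq,
    Prod.mk.injEq, ne_eq, if_true] at hs
  obtain ⟨⟨rfl, rfl⟩, hq, ⟨rfl, rfl⟩, hr, -⟩ := hs
  simp only [true_and] at hq hr
  have hsub : jq ≠ jq - 1 := by simp [eq_comm (a := jq)]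
  have hneg : ∀ c : Fin 3, c ≠ 0 → - c ≠ c := by decide
  refine ⟨_, hs'.spread (p := necklaceDart n (jq, sq, - cq)) ?_ ?_ ?_ ?_ ?_ ?_ ?_ ?_⟩
  all_goals
    simp only [necklace_vert, necklace_dinv, necklaceInv, EmbeddingLike.apply_eq_iff_eq,
      Prod.mk.injEq, ne_eq, if_true, hr, if_false, neg_eq_zero, hq]
    try cases sq <;> simp [hsub, hneg _ hq]

/-- A move on the necklace either gives the necklace again or creates a vertex with three
different neighbours. -/
lemma necklace_isIsomorphic_or_spread {x q r : Fin (6 * n)} (hs : (necklace n).Site x q r) :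
    ((necklace n).swapDarts q r).IsIsomorphic (necklace n) ∨
      ∃ w, ((necklace n).swapDarts q r).Spread w := by
  obtain ⟨⟨j, s, c⟩, rfl⟩ := (necklaceDart n).surjective x
  by_cases hc : c = 0
  · subst hc
    exact .inr (necklace_spread_of_single hs)
  have hsub : j ≠ j - 1 := by simp [eq_comm (a := j)]
  -- The mixed case: `r` belongs to a single edge and `q` to the other edge of the double edge.
  have mixed : ∀ (s : Bool) (q r : Fin (6 * n)),
      (necklace n).Site (necklaceDart n (j, s, c)) q r → q = necklaceDart n (j, s, - c) →
      r = necklaceDart n (j, !s, 0) → ∃ w, ((necklace n).swapDarts q r).Spread w := by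
    rintro s _ _ hs rfl rfl
    refine ⟨_, hs.spread (p := necklaceDart n (j, s, 0)) ?_ ?_ ?_ ?_ ?_ ?_ ?_ ?_⟩
    all_goals
      simp only [necklace_vert, necklace_dinv, necklaceInv, EmbeddingLike.apply_eq_iff_eq,
        Prod.mk.injEq, ne_eq, if_true, if_false, hc]
      try cases s <;> simp [eq_comm, hc, hsub]
  have dart_cases : ∀ c' : Fin 3, c' ≠ c → c' = 0 ∨ c' = - c := by
    clear mixed hs
    decide +revert
  have hs' := hs
  obtain ⟨⟨jq, sq, cq⟩, rfl⟩ := (necklaceDart n).surjective q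
  obtain ⟨⟨jr, sr, cr⟩, rfl⟩ := (necklaceDart n).surjective r
  simp only [Site, necklace_vert, necklace_dinv, necklaceInv, EmbeddingLike.apply_eq_iff_eq,
    Prod.mk.injEq, ne_eq, if_neg hc] at hs
  obtain ⟨⟨rfl, rfl⟩, hq, ⟨rfl, rfl⟩, hr, -⟩ := hs
  simp only [true_and] at hq hr
  have parallel : necklaceDart n (jr, !sq, - c) =
      (necklace n).dinv (necklaceDart n (jr, sq, - c)) := by
    simp [necklace_dinv, necklaceInv, hc]
  rcases dart_cases _ hq with rfl | rfl <;> rcases dart_cases _ hr with rfl | rfl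
  · left
    refine (hs'.swapDarts_isIsomorphic (q' := necklaceDart n (jr, sq, - c))
      (r' := necklaceDart n (jr, !sq, - c)) ?_ ?_ ?_).trans ?_
    · have hcc : - c ≠ c := by clear * - hc; decide +revert
      simp [Site, necklace_vert, necklace_dinv, necklaceInv, hc, hcc]
    · simp [hc]
    · simp [hc]
    · rw [parallel]
      exact swapDarts_dinv_isIsomorphic _ _
  · right
    rw [swapDarts_comm]
    refine mixed (!sq) _ _ ?_ rfl (by rw [Bool.not_not])
    have := hs'.flip
    simpa [necklace_dinv, necklaceInv, hc] using this
  · exact .inr (mixed sq _ _ hs' rfl rfl)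
  · left
    rw [parallel]
    exact swapDarts_dinv_isIsomorphic _ _

end Necklace

open Classical in
/-- The darts whose edge touches `w` or a neighbour of `w`. -/
noncomputable def nearDarts (g : CubicGraph n) (w : Fin (2 * n)) : Finset (Fin (6 * n)) :=
  Finset.univ.filter fun x =>
    (g.vert x = w ∨ ∃ d, g.vert d = w ∧ g.vert x = g.vert (g.dinv d)) ∨
    (g.vert (g.dinv x) = w ∨ ∃ d, g.vert d = w ∧ g.vert (g.dinv x) = g.vert (g.dinv d))

lemma card_nearDarts_le (g : CubicGraph n) (w : Fin (2 * n)) : (g.nearDarts w).card ≤ 24 := by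
  classical
  set F : Fin (2 * n) → Finset (Fin (6 * n)) := fun v => Finset.univ.filter fun d => g.vert d = v
    with hF
  set B := F w ∪ (F w).biUnion fun d => F (g.vert (g.dinv d)) with hB
  have hBcard : B.card ≤ 12 := by
    refine (Finset.card_union_le _ _).trans ?_
    have h1 := Finset.card_biUnion_le_card_mul (F w) (fun d => F (g.vert (g.dinv d))) 3
      (fun d _ => (g.regular _).le)
    have h2 : (F w).card = 3 := g.regular w
    omega
  have hsub : g.nearDarts w ⊆ B ∪ B.image g.dinv := by
    intro x hx
    simp only [nearDarts, Finset.mem_filter, Finset.mem_univ, true_and] at hx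
    rw [Finset.mem_union, Finset.mem_image]
    rcases hx with hx | hx
    · left
      simpa [hB, hF] using hx
    · right
      exact ⟨g.dinv x, by simpa [hB, hF] using hx, g.dinv_invol x⟩
  have h1 := Finset.card_le_card hsub
  have h2 := Finset.card_union_le B (B.image g.dinv)
  have h3 := Finset.card_image_le (s := B) (f := g.dinv)
  omega

lemma Spread.mem_nearDarts {g : CubicGraph n} {w : Fin (2 * n)} (hw : g.Spread w)
    {x q r : Fin (6 * n)} (hs : g.Site x q r) (hn : ∀ w, ¬ (g.swapDarts q r).Spread w) :
    x ∈ g.nearDarts w := by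
  by_contra hx
  simp only [nearDarts, Finset.mem_filter, Finset.mem_univ, true_and, not_or] at hx
  exact hn w (hw.swapDarts hs (by rw [not_or]; exact hx.1) (by rw [not_or]; exact hx.2))

end CubicGraph

section Boundary

open CubicGraph

variable {n : ℕ} [NeZero n]

/-- The class of the necklace. -/
noncomputable def necklaceClass (n : ℕ) [NeZero n] : GammaV n :=
  toClass (necklace n) necklace_connected

/-- The class reached from the necklace by the move `i` on a dart with position `0`. -/
noncomputable def necklaceNeighbor (p : Fin 2 × Bool × Fin 3) : GammaV n :=
  toClass ((necklace n).wh p.1 (necklaceDart n (0, p.2))) (necklace_connected.wh _ _)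

lemma not_spread_of_isIsomorphic_necklace {g : CubicGraph n}
    (h : g.IsIsomorphic (necklace n)) (w : Fin (2 * n)) : ¬ g.Spread w := by
  obtain ⟨f⟩ := h
  exact fun hw => necklace_not_spread _ (hw.map f)

/-- A graph from which a proper move leads to the necklace is a neighbour of the necklace. -/
lemma exists_necklaceNeighbor {g : CubicGraph n} (hg : g.Connected) {x q r : Fin (6 * n)}
    (hs : g.Site x q r) (h : (g.swapDarts q r).IsIsomorphic (necklace n)) :
    ∃ p, necklaceNeighbor p = toClass g hg := by
  have reverse : ∀ f : Iso (g.swapDarts q r) (necklace n),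
      (necklace n).Site (f.dartEquiv x) (f.dartEquiv r) (f.dartEquiv q) ∧
      g.IsIsomorphic ((necklace n).swapDarts (f.dartEquiv r) (f.dartEquiv q)) := by
    intro f
    refine ⟨hs.symm.map f, ?_⟩
    have := swapDarts_map f r q
    rwa [swapDarts_swapDarts] at this
  obtain ⟨f⟩ := h
  obtain ⟨⟨j, d⟩, hj⟩ := (necklaceDart n).surjective (f.dartEquiv x)
  obtain ⟨k, hk⟩ := necklace_rotation (n := n) (-j)
  obtain ⟨hs', hiso⟩ := reverse ⟨f.dartEquiv.trans k.dartEquiv, f.vertEquiv.trans k.vertEquiv,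
    fun d => by simp [k.map_dinv, f.map_dinv], fun d => by simp [k.map_vert, f.map_vert]⟩
  have hx : (f.dartEquiv.trans k.dartEquiv) x = necklaceDart n (0, d) := by
    rw [Equiv.trans_apply, ← hj, hk]
    simp
  rw [hx] at hs'
  obtain ⟨i, hi⟩ := hs'.exists_wh
  exact ⟨(i, d), (toClass_eq_iff _ _).2 (hi.trans hiso.symm)⟩

variable [Fact (1 < n)]

lemma exists_spread_of_necklace_site {g : CubicGraph n} {x q r : Fin (6 * n)}
    (hs : g.Site x q r) (h : (g.swapDarts q r).IsIsomorphic (necklace n))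
    (hne : ¬ g.IsIsomorphic (necklace n)) : ∃ w, g.Spread w := by
  obtain ⟨f⟩ := h
  have hiso := swapDarts_map f r q
  rw [swapDarts_swapDarts] at hiso
  rcases necklace_isIsomorphic_or_spread (hs.symm.map f) with h | ⟨w, hw⟩
  · exact absurd (hiso.trans h) hne
  · obtain ⟨f'⟩ := hiso.symm
    exact ⟨_, hw.map f'⟩

lemma exists_ne_necklaceClass : ∃ u : GammaV n, u ≠ necklaceClass n := by
  have hs : (necklace n).Site (necklaceDart n (0, true, 0)) (necklaceDart n (0, true, 1))
      (necklaceDart n (1, false, 1)) := by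
    simp [Site, necklace_vert, necklace_dinv, necklaceInv]
  refine ⟨toClass _ (necklace_connected.swapDarts hs), fun e => ?_⟩
  obtain ⟨w, hw⟩ := necklace_spread_of_single hs
  exact not_spread_of_isIsomorphic_necklace ((toClass_eq_iff _ _).1 e) w hw

/-- The moves which lead from another class to the class of the necklace. -/
lemma exists_spread_of_wh_necklace {u : GammaV n} (hu : u ≠ necklaceClass n) {i : Fin 2}
    {x : Fin (6 * n)} (h : ((Quot.out u).1.wh i x).IsIsomorphic (necklace n)) :
    (∃ p, necklaceNeighbor p = u) ∧ (∃ w, (Quot.out u).1.Spread w) ∧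
      ∀ w, (Quot.out u).1.Spread w → x ∈ (Quot.out u).1.nearDarts w := by
  have hne : ¬ (Quot.out u).1.IsIsomorphic (necklace n) := fun h => hu <| by
    rw [← toClass_out u]
    exact (toClass_eq_iff _ _).2 h
  rcases (Quot.out u).1.wh_eq_self_or_site i x with e | ⟨q, r, hs, e⟩ <;> rw [e] at h
  · exact absurd h hne
  · have hp := exists_necklaceNeighbor (Quot.out u).2 hs h
    rw [toClass_out] at hp
    exact ⟨hp, exists_spread_of_necklace_site hs h hne,
      fun w hw => hw.mem_nearDarts hs (not_spread_of_isIsomorphic_necklace h)⟩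

lemma boundaryCount_compl_necklaceClass_le : boundaryCount n {necklaceClass n}ᶜ ≤ 288 := by
  classical
  set K : Finset (GammaV n) := Finset.univ.image necklaceNeighbor with hK
  have hKcard : K.card ≤ 12 := Finset.card_image_le.trans (by simp)
  -- A vertex with three different neighbours, if there is one.
  let w : GammaV n → Fin (2 * n) := fun u =>
    if h : ∃ w, (Quot.out u).1.Spread w then h.choose else ⟨0, by have := NeZero.pos n; omega⟩
  let F : GammaV n → Finset (GammaV n × Fin 2 × Fin (6 * n)) := fun u =>
    (Finset.univ ×ˢ (Quot.out u).1.nearDarts (w u)).image fun p => (u, p)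
  have hF : ∀ u ∈ K, (F u).card ≤ 48 := by
    intro u _
    refine Finset.card_image_le.trans ?_
    rw [Finset.card_product, Finset.card_univ, Fintype.card_fin]
    have := (Quot.out u).1.card_nearDarts_le (w u)
    omega
  have hcard : (K.biUnion F).card ≤ 576 :=
    (Finset.card_biUnion_le_card_mul K F 48 hF).trans (by omega)
  set B : Set (GammaV n × Fin 2 × Fin (6 * n)) := {q | q.1 ∈ ({necklaceClass n}ᶜ : Set _) ∧
    ∀ v : GammaV n, CubicGraph.IsIsomorphic ((Quot.out q.1).1.wh q.2.1 q.2.2) (Quot.out v).1 →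
      v ∉ ({necklaceClass n}ᶜ : Set _)} with hB
  have hsub : B ⊆ K.biUnion F := by
    intro q hq
    obtain ⟨u, i, x⟩ := q
    rw [hB, Set.mem_ofPred_eq, Set.mem_compl_iff, Set.mem_singleton_iff] at hq
    have hu := hq.1
    have hv := hq.2
    have hwh : ((Quot.out u).1.wh i x).IsIsomorphic (necklace n) := by
      have hc := (Quot.out u).2.wh i x
      have := hv _ (out_toClass_isIsomorphic hc).symm
      rw [Set.mem_compl_iff, not_not, Set.mem_singleton_iff] at this
      exact (toClass_eq_iff _ _).1 this
    have key := exists_spread_of_wh_necklace hu hwh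
    have hex := key.2.1
    have hw : (Quot.out u).1.Spread (w u) := by
      simp only [w, dif_pos hex]
      exact hex.choose_spec
    have huK : u ∈ K := by
      rw [hK, Finset.mem_image]
      simpa only [Finset.mem_univ, true_and] using key.1
    rw [Finset.mem_coe, Finset.mem_biUnion]
    refine ⟨u, huK, ?_⟩
    rw [Finset.mem_image]
    refine ⟨(i, x), ?_, rfl⟩
    rw [Finset.mem_product]
    exact ⟨Finset.mem_univ _, key.2.2 _ hw⟩
  have hBcard : Nat.card B ≤ 576 := by
    rw [Nat.card_coe_set_eq]
    refine (Set.ncard_le_ncard hsub (Finset.finite_toSet _)).trans ?_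
    rwa [Set.ncard_coe_finset]
  have : boundaryCount n {necklaceClass n}ᶜ = Nat.card B / 2 := rfl
  omega

lemma phiOutSet_compl_necklaceClass_le :
    phiOutSet n {necklaceClass n}ᶜ ≤ 288 / (6 * n : ℝ) := by
  have hpos : 0 < n := NeZero.pos n
  have hd : ∀ S : Set (GammaV n), S.Nonempty → (6 * n : ℝ) ≤ dOut n S := by
    rintro S ⟨u, hu⟩
    have h := Nat.card_le_card_of_injective
      (fun p : Fin 2 × Fin (6 * n) =>
        (⟨(u, p), hu⟩ : {q : GammaV n × Fin 2 × Fin (6 * n) // q.1 ∈ S}))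
      (fun a b hab => by simpa using hab)
    have : 6 * n ≤ dOut n S := by
      unfold dOut
      rw [Nat.card_prod, Nat.card_fin, Nat.card_fin] at h
      omega
    exact_mod_cast this
  unfold phiOutSet
  have h6 : (0 : ℝ) < 6 * n := by positivity
  refine div_le_div₀ (by norm_num) ?_ h6 (le_min (hd _ ?_) (hd _ ?_))
  · exact_mod_cast boundaryCount_compl_necklaceClass_le
  · exact exists_ne_necklaceClass
  · rw [compl_compl]
    exact Set.singleton_nonempty _

end Boundary

lemma phiOutSet_nonneg (n : ℕ) (S : Set (GammaV n)) : 0 ≤ phiOutSet n S := by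
  unfold phiOutSet
  positivity

lemma phiOut_nonneg (n : ℕ) : 0 ≤ phiOut n :=
  Real.sInf_nonneg fun _ ⟨S, _, _, h⟩ => h ▸ phiOutSet_nonneg n S

lemma phiOut_le {n : ℕ} (hn : 2 ≤ n) : phiOut n ≤ 48 / n := by
  have : NeZero n := ⟨by omega⟩
  have : Fact (1 < n) := ⟨hn⟩
  have hpos : (0 : ℝ) < n := by exact_mod_cast (by omega : 0 < n)
  refine le_trans (csInf_le ⟨0, ?_⟩ ⟨{necklaceClass n}ᶜ, exists_ne_necklaceClass, ?_, rfl⟩)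
    (phiOutSet_compl_necklaceClass_le.trans (le_of_eq ?_))
  · rintro _ ⟨S, -, -, rfl⟩
    exact phiOutSet_nonneg n S
  · rw [compl_compl]
    exact Set.singleton_nonempty _
  · field_simp
    norm_num

theorem tendsto_phiOut : Filter.Tendsto (fun n : ℕ => phiOut (n + 1)) Filter.atTop (nhds 0) := by
  refine squeeze_zero' (.of_forall fun n => phiOut_nonneg _)
    (Filter.eventually_atTop.2 ⟨1, fun n hn => phiOut_le (by omega)⟩) ?_
  exact (Filter.tendsto_add_atTop_iff_nat (f := fun n : ℕ => (48 : ℝ) / n) 1).2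
    (tendsto_const_div_atTop_nhds_zero_nat 48)

/-- `Γ_n` is (strongly) connected, its outer conductance tends to `0` as
`n → ∞`, and consequently the family `{Γ_n}` is not a family of outer-expanders. -/
theorem gamma_connected_and_phiOut_tendsto_zero :
    (∀ n : ℕ, 1 ≤ n → ∀ u v : GammaV n,
      Relation.ReflTransGen
        (fun a b : GammaV n => ∃ (i : Fin 2) (x : Fin (6 * n)),
          CubicGraph.IsIsomorphic ((Quot.out a).1.wh i x) (Quot.out b).1) u v) ∧
    Filter.Tendsto (fun n : ℕ => phiOut (n + 1)) Filter.atTop (nhds 0) ∧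
    ¬ ∃ c : ℝ, 0 < c ∧ ∀ n : ℕ, 1 ≤ n → c ≤ phiOut n := by
  refine ⟨fun n hn u v => gamma_strongly_connected hn u v, tendsto_phiOut, ?_⟩
  rintro ⟨c, hc, h⟩
  exact hc.not_ge (ge_of_tendsto' tendsto_phiOut fun n => h (n + 1) (by omega))
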